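/- Let f(u) := u⁵ log(2+u²). There exists a function Φ : ℝ × ℝ → ℝ such that for every T > 0 and every spherically symmetric classical solution u of ∂ₜₜ u = Δu − f(u) on [0,T] × ℝ³, one has sup_{(t,x) ∈ [0,T] × ℝ³} |u(t,x)| ≤ Φ(E, D₀), where E is the conserved energy of u and D₀ := ‖∇_{t,x} u(0)‖_{H¹(ℝ³)}; in particular the L^∞ bound is uniform in T. -/

import Mathlib

open MeasureTheory Real

noncomputable section

/-- Physical space `ℝ³`. -/
abbrev Sp : Type := EuclideanSpace ℝ (Fin 3)

/-- The partial derivative of `u : ℝ³ → ℝ` in the `i`-th coordinate direction. -/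
noncomputable def pd (i : Fin 3) (u : Sp → ℝ) (x : Sp) : ℝ :=
  fderiv ℝ u x (EuclideanSpace.single i 1)

/-- The spatial Laplacian `Δu = ∑ i, ∂ᵢ∂ᵢ u`. -/
noncomputable def lap (u : Sp → ℝ) (x : Sp) : ℝ := ∑ i, pd i (pd i u) x

/-- The nonlinearity `f(u) = u⁵ log(2 + u²)`. -/
noncomputable def nonlin (u : ℝ) : ℝ := u ^ 5 * Real.log (2 + u ^ 2)

/-- The nonlinear potential `F(u) = ∫₀ᵘ f(v) dv`. -/
noncomputable def Fpot (u : ℝ) : ℝ := ∫ v in (0:ℝ)..u, nonlin v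

/-- A classical solution of `∂ₜₜ u = Δu - f(u)` on `I × ℝ³`: a smooth function which is
compactly supported in space for each time `t ∈ I` and solves the equation pointwise on
`I × ℝ³`. -/
def IsClassicalSolution (I : Set ℝ) (u : ℝ → Sp → ℝ) : Prop :=
  ContDiff ℝ (⊤ : ℕ∞) (fun p : ℝ × Sp => u p.1 p.2) ∧
  (∀ t ∈ I, HasCompactSupport (u t)) ∧
  (∀ t ∈ I, ∀ x, deriv (deriv fun s => u s x) t = lap (u t) x - nonlin (u t x))

/-- Spherical symmetry: `u(t,x)` depends only on `t` and `|x|`. -/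
def IsRadialSolution (I : Set ℝ) (u : ℝ → Sp → ℝ) : Prop :=
  ∀ t ∈ I, ∀ x y : Sp, ‖x‖ = ‖y‖ → u t x = u t y

/-- The energy `E(u)(t) = ∫ ½|∂ₜu|² + ½|∇ₓu|² + F(u) dx`. -/
noncomputable def energy (u : ℝ → Sp → ℝ) (t : ℝ) : ℝ :=
  ∫ x, ((1/2) * (deriv (fun s => u s x) t) ^ 2
      + (1/2) * ∑ i, (pd i (u t) x) ^ 2 + Fpot (u t x))

/-- `D(t) = ‖∇_{t,x} u(t)‖_{H¹(ℝ³)}`, where the `H¹` norm squared of the space-time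
gradient `(∂ₜu, ∂₁u, ∂₂u, ∂₃u)` is the integral of the squares of its components together
with the squares of all their first spatial derivatives. -/
noncomputable def Dquant (u : ℝ → Sp → ℝ) (t : ℝ) : ℝ :=
  Real.sqrt (∫ x, ((deriv (fun s => u s x) t) ^ 2 + ∑ i, (pd i (u t) x) ^ 2
    + ∑ i, (pd i (fun y => deriv (fun s => u s y) t) x) ^ 2
    + ∑ i, ∑ j, (pd i (pd j (u t)) x) ^ 2))

namespace LogWave

open scoped ContDiff

section

/-! ### Calculus of functions of `(t, r)` -/

/-- Time derivative of a function of `(t, r)`. -/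
def Dt (g : ℝ × ℝ → ℝ) (z : ℝ × ℝ) : ℝ := fderiv ℝ g z (1, 0)

/-- Space derivative of a function of `(t, r)`. -/
def Dr (g : ℝ × ℝ → ℝ) (z : ℝ × ℝ) : ℝ := fderiv ℝ g z (0, 1)

variable {g : ℝ × ℝ → ℝ}

lemma contDiff_Dt (h : ContDiff ℝ ∞ g) : ContDiff ℝ ∞ (Dt g) :=
  (h.fderiv_right (m := ∞) (by simp)).clm_apply contDiff_const

lemma contDiff_Dr (h : ContDiff ℝ ∞ g) : ContDiff ℝ ∞ (Dr g) :=
  (h.fderiv_right (m := ∞) (by simp)).clm_apply contDiff_const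

lemma hasDerivAt_line (h : ContDiff ℝ ∞ g) (ξ c t : ℝ) :
    HasDerivAt (fun s => g (s, ξ + c * s)) (Dt g (t, ξ + c * t) + c * Dr g (t, ξ + c * t)) t := by
  have h1 : HasFDerivAt g (fderiv ℝ g (t, ξ + c * t)) (t, ξ + c * t) :=
    (h.differentiable (by simp)).differentiableAt.hasFDerivAt
  have h2 : HasDerivAt (fun s : ℝ => (s, ξ + c * s)) ((1 : ℝ), c) t := by
    refine (hasDerivAt_id t).prodMk ?_
    simpa using ((hasDerivAt_id t).const_mul c).const_add ξ
  have h3 := h1.comp_hasDerivAt t h2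
  refine h3.congr_deriv ?_
  have : ((1 : ℝ), c) = (1, 0) + c • (0, 1) := by simp
  rw [this, map_add, map_smul]
  rfl

lemma hasDerivAt_t (h : ContDiff ℝ ∞ g) (t r : ℝ) :
    HasDerivAt (fun s => g (s, r)) (Dt g (t, r)) t := by
  simpa using hasDerivAt_line h r 0 t

lemma hasDerivAt_r (h : ContDiff ℝ ∞ g) (t r : ℝ) :
    HasDerivAt (fun s => g (t, s)) (Dr g (t, r)) r := by
  have h1 : HasFDerivAt g (fderiv ℝ g (t, r)) (t, r) :=
    (h.differentiable (by simp)).differentiableAt.hasFDerivAt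
  exact h1.comp_hasDerivAt r ((hasDerivAt_const r t).prodMk (hasDerivAt_id r))

lemma Dt_Dr_comm (h : ContDiff ℝ ∞ g) (z : ℝ × ℝ) : Dt (Dr g) z = Dr (Dt g) z := by
  have hs : IsSymmSndFDerivAt ℝ g z :=
    (h.contDiffAt (x := z)).isSymmSndFDerivAt (by simpa using WithTop.coe_le_coe.2 (le_top : (2 : ℕ∞) ≤ ⊤))
  have hd : DifferentiableAt ℝ (fderiv ℝ g) z :=
    ((h.fderiv_right (m := ∞) (by simp)).differentiable (by simp)).differentiableAt
  have e1 : ∀ a b : ℝ × ℝ, fderiv ℝ (fun y => fderiv ℝ g y a) z b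
      = fderiv ℝ (fderiv ℝ g) z b a := by
    intro a b
    have := (hd.hasFDerivAt.clm_apply (hasFDerivAt_const a z)).fderiv
    rw [this]; simp
  unfold Dt Dr
  rw [e1, e1]
  exact hs.eq _ _

lemma continuous_slice (h : ContDiff ℝ ∞ g) (t : ℝ) : Continuous fun x => g (t, x) :=
  h.continuous.comp (by fun_prop)

lemma hasDerivAt_integral (h : ContDiff ℝ ∞ g) (a b t : ℝ) :
    HasDerivAt (fun s => ∫ x in a..b, g (s, x)) (∫ x in a..b, Dt g (t, x)) t := by
  have hc : Continuous (Dt g) := (contDiff_Dt h).continuous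
  obtain ⟨C, hC⟩ := ((isCompact_closedBall t 1).prod (isCompact_uIcc (a := a) (b := b))).exists_bound_of_continuousOn
    hc.continuousOn
  refine (intervalIntegral.hasDerivAt_integral_of_dominated_loc_of_deriv_le
    (F := fun s x => g (s, x)) (F' := fun s x => Dt g (s, x)) (bound := fun _ => C)
    (Metric.closedBall_mem_nhds t one_pos) ?_ ?_ ?_ ?_ ?_ ?_).2
  · exact Filter.Eventually.of_forall fun s => (continuous_slice h s).aestronglyMeasurable
  · exact (continuous_slice h t).intervalIntegrable _ _
  · exact (continuous_slice (contDiff_Dt h) t).aestronglyMeasurable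
  · exact Filter.Eventually.of_forall fun x hx s hs => hC (s, x) ⟨hs, Set.uIoc_subset_uIcc hx⟩
  · exact intervalIntegrable_const
  · exact Filter.Eventually.of_forall fun x _ s _ => hasDerivAt_t h s x

lemma hasDerivAt_primitive_line (h : ContDiff ℝ ∞ g) (ξ c t : ℝ) :
    HasDerivAt (fun s => ∫ x in (0:ℝ)..(ξ + c * s), g (s, x))
      ((∫ x in (0:ℝ)..(ξ + c * t), Dt g (t, x)) + c * g (t, ξ + c * t)) t := by
  have hcD : Continuous (Dt g) := (contDiff_Dt h).continuous
  have c1 : Continuous fun z : ℝ × ℝ => ∫ x in (0:ℝ)..z.2, Dt g (z.1, x) :=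
    intervalIntegral.continuous_parametric_intervalIntegral_of_continuous
      (f := fun z : ℝ × ℝ => fun x => Dt g (z.1, x)) (by fun_prop) continuous_snd
  have key := hasStrictFDerivAt_uncurry_coprod (𝕜 := ℝ) (u := (t, ξ + c * t))
    (f := fun s r => ∫ x in (0:ℝ)..r, g (s, x))
    (f₁ := fun s r => ContinuousLinearMap.toSpanSingleton ℝ (∫ x in (0:ℝ)..r, Dt g (s, x)))
    (f₂ := fun s r => ContinuousLinearMap.toSpanSingleton ℝ (g (s, r)))
    (Filter.Eventually.of_forall fun v => (hasDerivAt_integral h 0 v.2 v.1).hasFDerivAt)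
    (Filter.Eventually.of_forall fun v => ((continuous_slice h v.1).integral_hasStrictDerivAt 0 v.2).hasDerivAt.hasFDerivAt)
    (((ContinuousLinearMap.toSpanSingletonCLE (𝕜 := ℝ) (E := ℝ)).continuous.comp c1).continuousAt)
    (((ContinuousLinearMap.toSpanSingletonCLE (𝕜 := ℝ) (E := ℝ)).continuous.comp h.continuous).continuousAt)
  have h2 : HasDerivAt (fun s : ℝ => (s, ξ + c * s)) ((1 : ℝ), c) t := by
    refine (hasDerivAt_id t).prodMk ?_
    simpa using ((hasDerivAt_id t).const_mul c).const_add ξ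
  have h3 := key.hasFDerivAt.comp_hasDerivAt t h2
  refine h3.congr_deriv ?_
  simp [Function.HasUncurry.uncurry]

end

/-! ### The potential -/

/-- The logarithmic weight `log (2 + v²)`. -/
def ell (v : ℝ) : ℝ := Real.log (2 + v ^ 2)

lemma half_le_ell (v : ℝ) : 1 / 2 ≤ ell v := by
  have h1 : Real.log 2 ≤ ell v := Real.log_le_log (by norm_num) (by nlinarith [sq_nonneg v])
  linarith [Real.log_two_gt_d9]

lemma ell_pos (v : ℝ) : 0 < ell v := by linarith [half_le_ell v]

lemma ell_le_ell {a b : ℝ} (h : |a| ≤ |b|) : ell a ≤ ell b :=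
  Real.log_le_log (by positivity) (by linarith [sq_le_sq.2 h])

lemma ell_quarter (a b : ℝ) (h : |a| ≤ 4 * |b|) : ell a ≤ 5 * ell b := by
  have h1 : a ^ 2 ≤ 16 * b ^ 2 := by
    rw [← sq_abs a, ← sq_abs b]; nlinarith [abs_nonneg a]
  have : 5 * ell b = Real.log ((2 + b ^ 2) ^ 5) := by
    rw [Real.log_pow]; norm_num [ell]
  rw [this]
  apply Real.log_le_log (by positivity)
  have hb := sq_nonneg b
  generalize b ^ 2 = x at *
  have : 2 + 16 * x ≤ (2 + x) ^ 5 := by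
    have : (2 + x) ^ 5 = 32 + 80 * x + x ^ 2 * (80 + 40 * x + 10 * x ^ 2 + x ^ 3) := by ring
    rw [this]
    have : 0 ≤ x ^ 2 * (80 + 40 * x + 10 * x ^ 2 + x ^ 3) := by positivity
    linarith
  linarith

lemma contDiff_ell : ContDiff ℝ ∞ ell := by
  unfold ell
  exact ContDiff.log (by fun_prop) (fun x => by positivity)

lemma nonlin_eq (v : ℝ) : nonlin v = v ^ 5 * ell v := rfl

lemma contDiff_nonlin : ContDiff ℝ ∞ nonlin :=
  (contDiff_id.pow 5).mul contDiff_ell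

lemma hasDerivAt_Fpot (v : ℝ) : HasDerivAt Fpot (nonlin v) v :=
  (contDiff_nonlin.continuous.integral_hasStrictDerivAt 0 v).hasDerivAt

lemma contDiff_Fpot : ContDiff ℝ ∞ Fpot := by
  rw [contDiff_infty_iff_deriv]
  refine ⟨fun v => (hasDerivAt_Fpot v).differentiableAt, ?_⟩
  have : deriv Fpot = nonlin := funext fun v => (hasDerivAt_Fpot v).deriv
  rw [this]; exact contDiff_nonlin

@[simp] lemma Fpot_zero : Fpot 0 = 0 := by simp [Fpot]

lemma hasDerivAt_ell (v : ℝ) : HasDerivAt ell (2 * v / (2 + v ^ 2)) v := by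
  have h : HasDerivAt (fun v : ℝ => 2 + v ^ 2) (2 * v) v := by
    simpa using (hasDerivAt_pow 2 v).const_add 2
  exact h.log (by positivity)

lemma nonneg_of_mul_deriv_nonneg {H H' : ℝ → ℝ} (hd : ∀ x, HasDerivAt H (H' x) x)
    (hs : ∀ x, 0 ≤ x * H' x) (h0 : H 0 = 0) (x : ℝ) : 0 ≤ H x := by
  have hc : Continuous H := continuous_iff_continuousAt.2 fun x => (hd x).continuousAt
  rcases le_total 0 x with hx | hx
  · have : MonotoneOn H (Set.Ici 0) := by
      refine monotoneOn_of_hasDerivWithinAt_nonneg (f' := H') (convex_Ici 0) hc.continuousOn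
        (fun y _ => (hd y).hasDerivWithinAt) (fun y hy => ?_)
      rw [interior_Ici] at hy
      exact nonneg_of_mul_nonneg_right (hs y) hy
    rw [← h0]; exact this Set.self_mem_Ici hx hx
  · have : AntitoneOn H (Set.Iic 0) := by
      refine antitoneOn_of_hasDerivWithinAt_nonpos (f' := H') (convex_Iic 0) hc.continuousOn
        (fun y _ => (hd y).hasDerivWithinAt) (fun y hy => ?_)
      rw [interior_Iic] at hy
      have hy' : y < 0 := hy
      by_contra hcon
      push Not at hcon
      nlinarith [hs y, mul_neg_of_neg_of_pos hy' hcon]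
    rw [← h0]; exact this hx Set.self_mem_Iic hx

lemma hasDerivAt_pow_six_mul_ell (v : ℝ) :
    HasDerivAt (fun v => v ^ 6 * ell v) (6 * v ^ 5 * ell v + v ^ 6 * (2 * v / (2 + v ^ 2))) v := by
  simpa using (hasDerivAt_pow 6 v).fun_mul (hasDerivAt_ell v)

lemma le_Fpot (v : ℝ) : v ^ 6 * ell v / 12 ≤ Fpot v := by
  rw [← sub_nonneg]
  refine nonneg_of_mul_deriv_nonneg (H := fun v => Fpot v - v ^ 6 * ell v / 12)
    (fun x => (hasDerivAt_Fpot x).sub ((hasDerivAt_pow_six_mul_ell x).div_const 12)) ?_ (by simp) v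
  intro x
  have e : x * (nonlin x - (6 * x ^ 5 * ell x + x ^ 6 * (2 * x / (2 + x ^ 2))) / 12)
      = x ^ 6 * (ell x / 2 - x ^ 2 / (2 + x ^ 2) / 6) := by
    rw [nonlin_eq]; ring
  rw [e]
  have h1 : x ^ 2 / (2 + x ^ 2) ≤ 1 := (div_le_one (by positivity)).2 (by linarith)
  have := half_le_ell x
  exact mul_nonneg (by positivity) (by linarith)

lemma Fpot_le (v : ℝ) : Fpot v ≤ v ^ 6 * ell v / 6 := by
  rw [← sub_nonneg]
  refine nonneg_of_mul_deriv_nonneg (H := fun v => v ^ 6 * ell v / 6 - Fpot v)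
    (fun x => ((hasDerivAt_pow_six_mul_ell x).div_const 6).sub (hasDerivAt_Fpot x)) ?_ (by simp) v
  intro x
  have e : x * ((6 * x ^ 5 * ell x + x ^ 6 * (2 * x / (2 + x ^ 2))) / 6 - nonlin x)
      = x ^ 6 * (x ^ 2 / (2 + x ^ 2)) / 3 := by
    rw [nonlin_eq]; ring
  rw [e]
  positivity

lemma Fpot_nonneg (v : ℝ) : 0 ≤ Fpot v :=
  le_trans (by have := ell_pos v; positivity) (le_Fpot v)

lemma eq_zero_of_Fpot {v : ℝ} (h : Fpot v = 0) : v = 0 := by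
  have h1 := le_Fpot v
  have h2 := ell_pos v
  by_contra hv
  have : 0 < v ^ 6 * ell v / 12 := by positivity
  linarith

section

/-! ### The reduced equation on the line -/

/-- The function `r v(t, r)`. -/
def rad (v : ℝ × ℝ → ℝ) (z : ℝ × ℝ) : ℝ := z.2 * v z

/-- `v` is the even profile of a spherically symmetric solution, so that `r v` solves a one
dimensional wave equation. -/
structure IsProfile (T : ℝ) (v : ℝ × ℝ → ℝ) : Prop where
  pos : 0 < T
  smooth : ContDiff ℝ ∞ v
  even : ∀ t ∈ Set.Icc 0 T, ∀ r, v (t, -r) = v (t, r)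
  eqn : ∀ t ∈ Set.Icc 0 T, ∀ r,
    Dt (Dt (rad v)) (t, r) = Dr (Dr (rad v)) (t, r) - r * nonlin (v (t, r))

/-- The energy density. -/
def eden (v : ℝ × ℝ → ℝ) (z : ℝ × ℝ) : ℝ :=
  1 / 2 * Dt (rad v) z ^ 2 + 1 / 2 * Dr (rad v) z ^ 2 + z.2 ^ 2 * Fpot (v z)

/-- The momentum density. -/
def mden (v : ℝ × ℝ → ℝ) (z : ℝ × ℝ) : ℝ := Dt (rad v) z * Dr (rad v) z

/-- The derivative `(∂ₜ + ∂ᵣ)(r v)`, transversal to the incoming characteristics. -/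
def inc (v : ℝ × ℝ → ℝ) (z : ℝ × ℝ) : ℝ := Dt (rad v) z + Dr (rad v) z

/-- The energy between the origin and radius `r`. -/
def Phi (v : ℝ × ℝ → ℝ) (t r : ℝ) : ℝ := ∫ x in (0:ℝ)..r, eden v (t, x)

variable {T : ℝ} {v : ℝ × ℝ → ℝ}

/-- Two differentiable functions that agree on `[0, T]` have the same derivative there. -/
lemma deriv_unique_Icc {f g : ℝ → ℝ} {f' g' t : ℝ} (hT : 0 < T) (ht : t ∈ Set.Icc 0 T)
    (hf : HasDerivAt f f' t) (hg : HasDerivAt g g' t) (h : ∀ s ∈ Set.Icc 0 T, f s = g s) :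
    f' = g' := by
  have hu := (uniqueDiffOn_Icc hT) t ht
  exact hu.eq_deriv _ hf.hasDerivWithinAt (hg.hasDerivWithinAt.congr h (h t ht))

lemma contDiff_rad (h : ContDiff ℝ ∞ v) : ContDiff ℝ ∞ (rad v) := contDiff_snd.mul h

lemma Dt_rad (h : ContDiff ℝ ∞ v) (z : ℝ × ℝ) : Dt (rad v) z = z.2 * Dt v z := by
  obtain ⟨t, r⟩ := z
  exact (hasDerivAt_t (contDiff_rad h) t r).unique ((hasDerivAt_t h t r).const_mul r)

lemma Dr_rad (h : ContDiff ℝ ∞ v) (z : ℝ × ℝ) : Dr (rad v) z = v z + z.2 * Dr v z := by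
  obtain ⟨t, r⟩ := z
  simpa using (hasDerivAt_r (contDiff_rad h) t r).unique ((hasDerivAt_id r).mul (hasDerivAt_r h t r))

lemma contDiff_eden (h : ContDiff ℝ ∞ v) : ContDiff ℝ ∞ (eden v) := by
  have h1 := contDiff_Dt (contDiff_rad h)
  have h2 := contDiff_Dr (contDiff_rad h)
  have h3 := contDiff_Fpot.comp h
  exact ((contDiff_const.mul (h1.pow 2)).add (contDiff_const.mul (h2.pow 2))).add
    ((contDiff_snd.pow 2).mul h3)

lemma contDiff_mden (h : ContDiff ℝ ∞ v) : ContDiff ℝ ∞ (mden v) :=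
  (contDiff_Dt (contDiff_rad h)).mul (contDiff_Dr (contDiff_rad h))

lemma contDiff_inc (h : ContDiff ℝ ∞ v) : ContDiff ℝ ∞ (inc v) :=
  (contDiff_Dt (contDiff_rad h)).add (contDiff_Dr (contDiff_rad h))

lemma eden_nonneg (z : ℝ × ℝ) : 0 ≤ eden v z := by
  have := Fpot_nonneg (v z)
  unfold eden; positivity

lemma abs_mden_add_le (z : ℝ × ℝ) : |mden v z| + z.2 ^ 2 * Fpot (v z) ≤ eden v z := by
  have : |mden v z| ≤ 1 / 2 * Dt (rad v) z ^ 2 + 1 / 2 * Dr (rad v) z ^ 2 := by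
    rw [mden, abs_le]
    constructor <;> nlinarith [sq_nonneg (Dt (rad v) z + Dr (rad v) z), sq_nonneg (Dt (rad v) z - Dr (rad v) z)]
  unfold eden; linarith

lemma abs_mden_le (z : ℝ × ℝ) : |mden v z| ≤ eden v z := by
  have := Fpot_nonneg (v z)
  have h2 := abs_mden_add_le (v := v) z
  have : 0 ≤ z.2 ^ 2 * Fpot (v z) := by positivity
  linarith

namespace IsProfile

lemma rad_smooth (h : IsProfile T v) : ContDiff ℝ ∞ (rad v) := contDiff_rad h.smooth

lemma Dt_eden (h : IsProfile T v) {t : ℝ} (ht : t ∈ Set.Icc 0 T) (r : ℝ) :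
    Dt (eden v) (t, r) = Dr (mden v) (t, r) := by
  have hw := h.rad_smooth
  have h1 := hasDerivAt_t (contDiff_Dt hw) t r
  have h2 := hasDerivAt_t (contDiff_Dr hw) t r
  have h3 := (hasDerivAt_Fpot (v (t, r))).comp t (hasDerivAt_t h.smooth t r)
  have h4 := (((h1.pow 2).const_mul (1 / 2)).add ((h2.pow 2).const_mul (1 / 2))).add
    (h3.const_mul (r ^ 2))
  have e1 := (hasDerivAt_t (contDiff_eden h.smooth) t r).unique h4
  have h5 := (hasDerivAt_r (contDiff_Dt hw) t r).mul (hasDerivAt_r (contDiff_Dr hw) t r)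
  have e2 := (hasDerivAt_r (contDiff_mden h.smooth) t r).unique h5
  rw [e1, e2, Dt_Dr_comm hw, h.eqn t ht, Dt_rad h.smooth]
  simp only [Nat.cast_ofNat]
  ring

lemma mden_zero (h : IsProfile T v) (t : ℝ) : mden v (t, 0) = 0 := by
  simp [mden, Dt_rad h.smooth]

lemma Phi_line (h : IsProfile T v) {t : ℝ} (ht : t ∈ Set.Icc 0 T) (ξ c : ℝ) :
    HasDerivAt (fun s => Phi v s (ξ + c * s)) (mden v (t, ξ + c * t) + c * eden v (t, ξ + c * t)) t := by
  refine (hasDerivAt_primitive_line (contDiff_eden h.smooth) ξ c t).congr_deriv ?_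
  congr 1
  rw [intervalIntegral.integral_congr (fun x _ => h.Dt_eden ht x),
    intervalIntegral.integral_eq_sub_of_hasDerivAt
      (fun x _ => hasDerivAt_r (contDiff_mden h.smooth) t x)
      ((continuous_slice (contDiff_Dr (contDiff_mden h.smooth)) t).intervalIntegrable _ _),
    h.mden_zero, sub_zero]

lemma inc_line (h : IsProfile T v) {t : ℝ} (ht : t ∈ Set.Icc 0 T) (ξ : ℝ) :
    HasDerivAt (fun s => inc v (s, ξ + -1 * s))
      (-((ξ + -1 * t) * nonlin (v (t, ξ + -1 * t)))) t := by
  refine (hasDerivAt_line (contDiff_inc h.smooth) ξ (-1) t).congr_deriv ?_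
  have hw := h.rad_smooth
  have e1 : ∀ z, Dt (inc v) z = Dt (Dt (rad v)) z + Dt (Dr (rad v)) z := fun z =>
    (hasDerivAt_t (contDiff_inc h.smooth) z.1 z.2).unique
      ((hasDerivAt_t (contDiff_Dt hw) z.1 z.2).add (hasDerivAt_t (contDiff_Dr hw) z.1 z.2))
  have e2 : ∀ z, Dr (inc v) z = Dr (Dt (rad v)) z + Dr (Dr (rad v)) z := fun z =>
    (hasDerivAt_r (contDiff_inc h.smooth) z.1 z.2).unique
      ((hasDerivAt_r (contDiff_Dt hw) z.1 z.2).add (hasDerivAt_r (contDiff_Dr hw) z.1 z.2))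
  rw [e1, e2, Dt_Dr_comm hw, h.eqn t ht]
  ring

lemma Dt_even (h : IsProfile T v) {t : ℝ} (ht : t ∈ Set.Icc 0 T) (r : ℝ) :
    Dt v (t, -r) = Dt v (t, r) :=
  deriv_unique_Icc h.pos ht (hasDerivAt_t h.smooth t (-r)) (hasDerivAt_t h.smooth t r)
    (fun s hs => h.even s hs r)

lemma Dr_odd (h : IsProfile T v) {t : ℝ} (ht : t ∈ Set.Icc 0 T) (r : ℝ) :
    Dr v (t, -r) = -Dr v (t, r) := by
  have h1 : HasDerivAt (fun x => v (t, -x)) (Dr v (t, -r) * -1) r :=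
    (hasDerivAt_r h.smooth t (-r)).comp r (hasDerivAt_neg r)
  have h2 : (fun x => v (t, -x)) = fun x => v (t, x) := funext fun x => h.even t ht x
  rw [h2] at h1
  have := h1.unique (hasDerivAt_r h.smooth t r)
  linarith

/-! #### Finite speed of propagation -/

lemma Phi_mono (h : IsProfile T v) (t : ℝ) : Monotone (Phi v t) := by
  intro a b hab
  have hi : ∀ x y, IntervalIntegrable (fun x => eden v (t, x)) volume x y :=
    fun x y => (continuous_slice (contDiff_eden h.smooth) t).intervalIntegrable _ _
  have := intervalIntegral.integral_interval_sub_left (hi 0 b) (hi 0 a)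
  have h2 : 0 ≤ ∫ x in a..b, eden v (t, x) :=
    intervalIntegral.integral_nonneg hab fun x _ => eden_nonneg _
  unfold Phi; linarith

lemma hasDerivAt_Phi (h : IsProfile T v) (t r : ℝ) :
    HasDerivAt (Phi v t) (eden v (t, r)) r :=
  ((continuous_slice (contDiff_eden h.smooth) t).integral_hasStrictDerivAt 0 r).hasDerivAt

lemma eden_eq_zero_of_Phi (h : IsProfile T v) {t a : ℝ}
    (hc : ∀ r, a ≤ r → Phi v t r = Phi v t a) {r : ℝ} (hr : a < r) : eden v (t, r) = 0 := by
  have h1 := h.hasDerivAt_Phi t r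
  have h2 : HasDerivAt (Phi v t) 0 r := by
    refine (hasDerivAt_const r (Phi v t a)).congr_of_eventuallyEq ?_
    filter_upwards [Ioi_mem_nhds hr] with x hx using hc x (le_of_lt hx)
  exact h1.unique h2

lemma Phi_const_of_eden (h : IsProfile T v) {t a : ℝ}
    (hc : ∀ r, a ≤ r → eden v (t, r) = 0) {r : ℝ} (hr : a ≤ r) : Phi v t r = Phi v t a := by
  have hi : ∀ x y, IntervalIntegrable (fun x => eden v (t, x)) volume x y :=
    fun x y => (continuous_slice (contDiff_eden h.smooth) t).intervalIntegrable _ _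
  have h1 := intervalIntegral.integral_interval_sub_left (hi 0 r) (hi 0 a)
  have h2 : ∫ x in a..r, eden v (t, x) = ∫ x in a..r, (0:ℝ) :=
    intervalIntegral.integral_congr fun x hx => hc x (by rw [Set.uIcc_of_le hr] at hx; exact hx.1)
  rw [h2] at h1
  simp at h1
  unfold Phi; linarith

lemma sub_Phi_nonincreasing (h : IsProfile T v) {a b t0 t1 : ℝ}
    (h0 : 0 ≤ t0) (h01 : t0 ≤ t1) (h1 : t1 ≤ T) :
    Phi v t1 (b + -1 * t1) - Phi v t1 (a + 1 * t1)
      ≤ Phi v t0 (b + -1 * t0) - Phi v t0 (a + 1 * t0) := by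
  have hd : ∀ t ∈ Set.Icc t0 t1, HasDerivAt
      (fun t => Phi v t (b + -1 * t) - Phi v t (a + 1 * t)) _ t := fun t ht =>
    (h.Phi_line ⟨h0.trans ht.1, ht.2.trans h1⟩ b (-1)).sub
      (h.Phi_line ⟨h0.trans ht.1, ht.2.trans h1⟩ a 1)
  refine antitoneOn_of_hasDerivWithinAt_nonpos (convex_Icc t0 t1)
    (fun t ht => (hd t ht).continuousAt.continuousWithinAt)
    (fun t ht => (hd t (interior_subset ht)).hasDerivWithinAt) (fun t _ => ?_)
    (Set.left_mem_Icc.2 h01) (Set.right_mem_Icc.2 h01) h01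
  have e1 := abs_le.1 (abs_mden_le (v := v) (t, b + -1 * t))
  have e2 := abs_le.1 (abs_mden_le (v := v) (t, a + 1 * t))
  linarith [e1.2, e2.1]

lemma sub_Phi_nondecreasing (h : IsProfile T v) {a b t0 t1 : ℝ}
    (h0 : 0 ≤ t0) (h01 : t0 ≤ t1) (h1 : t1 ≤ T) :
    Phi v t0 (b + 1 * t0) - Phi v t0 (a + -1 * t0)
      ≤ Phi v t1 (b + 1 * t1) - Phi v t1 (a + -1 * t1) := by
  have hd : ∀ t ∈ Set.Icc t0 t1, HasDerivAt
      (fun t => Phi v t (b + 1 * t) - Phi v t (a + -1 * t)) _ t := fun t ht =>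
    (h.Phi_line ⟨h0.trans ht.1, ht.2.trans h1⟩ b 1).sub
      (h.Phi_line ⟨h0.trans ht.1, ht.2.trans h1⟩ a (-1))
  refine monotoneOn_of_hasDerivWithinAt_nonneg (convex_Icc t0 t1)
    (fun t ht => (hd t ht).continuousAt.continuousWithinAt)
    (fun t ht => (hd t (interior_subset ht)).hasDerivWithinAt) (fun t _ => ?_)
    (Set.left_mem_Icc.2 h01) (Set.right_mem_Icc.2 h01) h01
  have e1 := abs_le.1 (abs_mden_le (v := v) (t, b + 1 * t))
  have e2 := abs_le.1 (abs_mden_le (v := v) (t, a + -1 * t))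
  linarith [e1.1, e2.2]

lemma eq_zero_of_eden (z : ℝ × ℝ) (hz : 0 < z.2) (he : eden v z = 0) : v z = 0 := by
  have h1 := Fpot_nonneg (v z)
  have h2 : 0 < z.2 ^ 2 := by positivity
  have h3 := abs_mden_add_le (v := v) z
  have h4 := abs_nonneg (mden v z)
  apply eq_zero_of_Fpot
  nlinarith

lemma finite_speed (h : IsProfile T v) {t0 n : ℝ} (hn : 0 ≤ n) (ht0 : t0 ∈ Set.Icc 0 T)
    (hz : ∀ r, n ≤ r → eden v (t0, r) = 0) {t1 r : ℝ} (ht1 : t1 ∈ Set.Icc 0 T)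
    (hr : n + |t1 - t0| < r) : v (t1, r) = 0 := by
  have habs := abs_nonneg (t1 - t0)
  refine eq_zero_of_eden _ (by simp only; linarith)
    (h.eden_eq_zero_of_Phi (a := n + |t1 - t0|) (fun ρ hρ => ?_) hr)
  refine le_antisymm ?_ (h.Phi_mono t1 hρ)
  rcases le_total t0 t1 with hle | hle
  · rw [abs_of_nonneg (by linarith)] at *
    have := h.sub_Phi_nonincreasing (a := n - t0) (b := ρ + t1) ht0.1 hle ht1.2
    have e1 : ρ + t1 + -1 * t1 = ρ := by ring
    have e2 : n - t0 + 1 * t1 = n + (t1 - t0) := by ring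
    have e3 : n - t0 + 1 * t0 = n := by ring
    rw [e1, e2, e3, h.Phi_const_of_eden hz (r := ρ + t1 + -1 * t0) (by linarith)] at this
    linarith
  · rw [abs_of_nonpos (by linarith)] at *
    have := h.sub_Phi_nondecreasing (a := n + t0) (b := ρ - t1) ht1.1 hle ht0.2
    have e1 : ρ - t1 + 1 * t1 = ρ := by ring
    have e2 : n + t0 + -1 * t1 = n + -(t1 - t0) := by ring
    have e3 : n + t0 + -1 * t0 = n := by ring
    rw [e1, e2, e3, h.Phi_const_of_eden hz (r := ρ - t1 + 1 * t0) (by linarith)] at this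
    linarith

lemma exists_uniform_support (h : IsProfile T v)
    (hs : ∀ t ∈ Set.Icc 0 T, ∃ n : ℕ, ∀ r, (n : ℝ) ≤ r → v (t, r) = 0) :
    ∃ R, 0 < R ∧ ∀ t ∈ Set.Icc 0 T, ∀ r, R ≤ |r| → v (t, r) = 0 := by
  let A : ℕ → Set ℝ := fun n => (Set.Ioo 0 T)ᶜ ∪ {t | ∀ r, (n : ℝ) ≤ r → v (t, r) = 0}
  have hA : ∀ n, IsClosed (A n) := by
    intro n
    refine isOpen_Ioo.isClosed_compl.union ?_
    simp only [Set.ofPred_forall]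
    refine isClosed_iInter fun r => isClosed_iInter fun _ => ?_
    exact isClosed_eq (h.smooth.continuous.comp (by fun_prop)) continuous_const
  have hU : ⋃ n, A n = Set.univ := by
    refine Set.eq_univ_of_forall fun t => ?_
    by_cases ht : t ∈ Set.Ioo 0 T
    · obtain ⟨n, hn⟩ := hs t ⟨ht.1.le, ht.2.le⟩
      exact Set.mem_iUnion.2 ⟨n, Or.inr hn⟩
    · exact Set.mem_iUnion.2 ⟨0, Or.inl ht⟩
  obtain ⟨t0, ht0, hmem⟩ := (dense_iUnion_interior_of_closed hA hU).exists_mem_open isOpen_Ioo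
    (⟨T / 2, by constructor <;> linarith [h.pos]⟩ : (Set.Ioo 0 T).Nonempty)
  obtain ⟨n, hn⟩ := Set.mem_iUnion.1 ht0
  have hev : ∀ᶠ t in nhds t0, ∀ r, (n : ℝ) ≤ r → v (t, r) = 0 := by
    filter_upwards [isOpen_interior.mem_nhds hn, isOpen_Ioo.mem_nhds hmem] with t h1 h2
    exact (interior_subset h1).resolve_left (fun hc => hc h2)
  have hz : ∀ r, (n : ℝ) + 1 ≤ r → eden v (t0, r) = 0 := by
    intro r hr
    have e0 : v (t0, r) = 0 := hev.self_of_nhds r (by linarith)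
    have e1 : Dt v (t0, r) = 0 := by
      refine (hasDerivAt_t h.smooth t0 r).unique ((hasDerivAt_const t0 (0:ℝ)).congr_of_eventuallyEq ?_)
      filter_upwards [hev] with t ht using ht r (by linarith)
    have e2 : Dr v (t0, r) = 0 := by
      refine (hasDerivAt_r h.smooth t0 r).unique ((hasDerivAt_const r (0:ℝ)).congr_of_eventuallyEq ?_)
      filter_upwards [Ioi_mem_nhds (show (n : ℝ) < r by linarith)] with x hx
        using hev.self_of_nhds x (le_of_lt hx)
    simp [eden, Dt_rad h.smooth, Dr_rad h.smooth, e0, e1, e2]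
  have hT := h.pos
  refine ⟨n + T + 2, by positivity, fun t ht r hr => ?_⟩
  have key : v (t, |r|) = 0 := by
    refine h.finite_speed (t0 := t0) (n := n + 1) (by positivity) ⟨hmem.1.le, hmem.2.le⟩ hz ht ?_
    have : |t - t0| ≤ T := abs_le.2 ⟨by linarith [ht.1, hmem.2], by linarith [ht.2, hmem.1]⟩
    linarith
  rcases abs_choice r with hc | hc
  · rwa [hc] at key
  · rwa [hc, h.even t ht] at key

end IsProfile

end

section

variable {T : ℝ} {v : ℝ × ℝ → ℝ}

/-- Integral form of the mean value inequality. -/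
lemma integral_le_sub_of_deriv_le {f f' g : ℝ → ℝ} {a b : ℝ} (hab : a ≤ b)
    (hf : ∀ t ∈ Set.Icc a b, HasDerivAt f (f' t) t) (hg : ContinuousOn g (Set.Icc a b))
    (h : ∀ t ∈ Set.Icc a b, g t ≤ f' t) : ∫ t in a..b, g t ≤ f b - f a :=
  intervalIntegral.integral_le_sub_of_hasDeriv_right_of_le hab
    (fun t ht => (hf t ht).continuousAt.continuousWithinAt)
    (fun t ht => (hf t ⟨ht.1.le, ht.2.le⟩).hasDerivWithinAt)
    (hg.integrableOn_Icc) (fun t ht => h t ⟨ht.1.le, ht.2.le⟩)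

/-- The radial momentum within radius `R`. -/
def mom (v : ℝ × ℝ → ℝ) (R t : ℝ) : ℝ := ∫ x in (0:ℝ)..R, mden v (t, x)

namespace IsProfile

/-! #### Energy flux and the Morawetz inequality -/

lemma flux (h : IsProfile T v) {E₁ : ℝ} (hE : ∀ t ∈ Set.Icc 0 T, ∀ r, |Phi v t r| ≤ E₁)
    {t0 t1 : ℝ} (h0 : 0 ≤ t0) (h01 : t0 ≤ t1) (h1 : t1 ≤ T) (ξ : ℝ) :
    ∫ s in t0..t1, (ξ + -1 * s) ^ 2 * Fpot (v (s, ξ + -1 * s)) ≤ 2 * E₁ := by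
  have hc : Continuous fun s : ℝ => (ξ + -1 * s) ^ 2 * Fpot (v (s, ξ + -1 * s)) := by
    have h1 := contDiff_Fpot.continuous
    have h2 := h.smooth.continuous
    fun_prop
  have hsub : ∀ t ∈ Set.Icc t0 t1, t ∈ Set.Icc 0 T := fun t ht => ⟨h0.trans ht.1, ht.2.trans h1⟩
  have key := integral_le_sub_of_deriv_le (f := fun s => -Phi v s (ξ + -1 * s)) h01
    (fun t ht => (h.Phi_line (hsub t ht) ξ (-1)).neg) hc.continuousOn (fun t _ => by
      have e1 := abs_mden_add_le (v := v) (t, ξ + -1 * t)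
      have e2 := le_abs_self (mden v (t, ξ + -1 * t))
      simp only at e1
      linarith)
  have a1 := abs_le.1 (hE t0 (hsub _ (Set.left_mem_Icc.2 h01)) (ξ + -1 * t0))
  have a2 := abs_le.1 (hE t1 (hsub _ (Set.right_mem_Icc.2 h01)) (ξ + -1 * t1))
  linarith [a1.2, a2.1]

lemma Dt_mden (h : IsProfile T v) {t : ℝ} (ht : t ∈ Set.Icc 0 T) (r : ℝ) :
    Dt (mden v) (t, r) = Dr (fun z => eden v z - 2 * (z.2 ^ 2 * Fpot (v z))) (t, r)
      - r * (v (t, r) * nonlin (v (t, r)) - 2 * Fpot (v (t, r))) := by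
  have hw := h.rad_smooth
  have hF : ContDiff ℝ ∞ fun z : ℝ × ℝ => z.2 ^ 2 * Fpot (v z) :=
    (contDiff_snd.pow 2).mul (contDiff_Fpot.comp h.smooth)
  have hk : ContDiff ℝ ∞ fun z => eden v z - 2 * (z.2 ^ 2 * Fpot (v z)) :=
    (contDiff_eden h.smooth).sub (contDiff_const.mul hF)
  have h1 := hasDerivAt_r (contDiff_Dt hw) t r
  have h2 := hasDerivAt_r (contDiff_Dr hw) t r
  have h3 := (hasDerivAt_Fpot (v (t, r))).comp r (hasDerivAt_r h.smooth t r)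
  have h6 := (hasDerivAt_pow 2 r).mul h3
  have h4 := ((((h1.pow 2).const_mul (1 / 2)).add ((h2.pow 2).const_mul (1 / 2))).add h6).sub
    (h6.const_mul 2)
  have e1 := (hasDerivAt_r hk t r).unique h4
  have h5 := (hasDerivAt_t (contDiff_Dt hw) t r).mul (hasDerivAt_t (contDiff_Dr hw) t r)
  have e2 := (hasDerivAt_t (contDiff_mden h.smooth) t r).unique h5
  rw [e1, e2, Dt_Dr_comm hw, h.eqn t ht, Dr_rad h.smooth]
  simp only [Nat.cast_ofNat, Function.comp_apply]
  ring

lemma hasDerivAt_mom (h : IsProfile T v) (R t : ℝ) :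
    HasDerivAt (mom v R) (∫ x in (0:ℝ)..R, Dt (mden v) (t, x)) t :=
  hasDerivAt_integral (contDiff_mden h.smooth) 0 R t

lemma eden_eq_zero_outside (h : IsProfile T v) {R₀ : ℝ}
    (hR : ∀ t ∈ Set.Icc 0 T, ∀ r, R₀ ≤ |r| → v (t, r) = 0) {t r : ℝ} (ht : t ∈ Set.Icc 0 T)
    (hr : R₀ < r) : eden v (t, r) = 0 := by
  have hr' : R₀ ≤ |r| := hr.le.trans (le_abs_self r)
  have e0 : v (t, r) = 0 := hR t ht r hr'
  have e1 : Dt v (t, r) = 0 :=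
    deriv_unique_Icc h.pos ht (hasDerivAt_t h.smooth t r) (hasDerivAt_const t (0:ℝ))
      (fun s hs => hR s hs r hr')
  have e2 : Dr v (t, r) = 0 := by
    refine (hasDerivAt_r h.smooth t r).unique ((hasDerivAt_const r (0:ℝ)).congr_of_eventuallyEq ?_)
    filter_upwards [Ioi_mem_nhds hr] with x hx using hR t ht x (le_trans (le_of_lt hx) (le_abs_self x))
  simp [eden, Dt_rad h.smooth, Dr_rad h.smooth, e0, e1, e2]

lemma deriv_mom_le (h : IsProfile T v) {R₀ : ℝ}
    (hR : ∀ t ∈ Set.Icc 0 T, ∀ r, R₀ ≤ |r| → v (t, r) = 0) (hR0 : 0 < R₀) {t : ℝ}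
    (ht : t ∈ Set.Icc 0 T) :
    ∫ x in (0:ℝ)..(R₀ + 1), Dt (mden v) (t, x)
      ≤ -(2 / 3 * ∫ x in (0:ℝ)..(R₀ + 1), x * (v (t, x) ^ 6 * ell (v (t, x)))) := by
  have hk : ContDiff ℝ ∞ fun z => eden v z - 2 * (z.2 ^ 2 * Fpot (v z)) :=
    (contDiff_eden h.smooth).sub (contDiff_const.mul
      ((contDiff_snd.pow 2).mul (contDiff_Fpot.comp h.smooth)))
  have cv := h.smooth.continuous
  have cF := contDiff_Fpot.continuous
  have cn := contDiff_nonlin.continuous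
  have ce := contDiff_ell.continuous
  have c1 : Continuous fun x => x * (v (t, x) * nonlin (v (t, x)) - 2 * Fpot (v (t, x))) := by
    fun_prop
  have c2 : Continuous fun x => x * (v (t, x) ^ 6 * ell (v (t, x))) := by fun_prop
  rw [intervalIntegral.integral_congr (fun x _ => h.Dt_mden ht x),
    intervalIntegral.integral_sub ((continuous_slice (contDiff_Dr hk) t).intervalIntegrable _ _)
      (c1.intervalIntegrable _ _),
    intervalIntegral.integral_eq_sub_of_hasDerivAt (fun x _ => hasDerivAt_r hk t x)
      ((continuous_slice (contDiff_Dr hk) t).intervalIntegrable _ _)]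
  have e1 : eden v (t, R₀ + 1) = 0 := h.eden_eq_zero_outside hR ht (by linarith)
  have e2 := eden_nonneg (v := v) (t, 0)
  have e3 : v (t, R₀ + 1) = 0 := hR t ht _ (by rw [abs_of_pos] <;> linarith)
  have e4 : 2 / 3 * ∫ x in (0:ℝ)..(R₀ + 1), x * (v (t, x) ^ 6 * ell (v (t, x)))
      ≤ ∫ x in (0:ℝ)..(R₀ + 1), x * (v (t, x) * nonlin (v (t, x)) - 2 * Fpot (v (t, x))) := by
    rw [← intervalIntegral.integral_const_mul]
    refine intervalIntegral.integral_mono_on (by linarith) ((c2.const_mul _).intervalIntegrable _ _)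
      (c1.intervalIntegrable _ _) (fun x hx => ?_)
    have := Fpot_le (v (t, x))
    have h6 : v (t, x) * nonlin (v (t, x)) = v (t, x) ^ 6 * ell (v (t, x)) := by
      rw [nonlin_eq]; ring
    rw [h6]
    nlinarith [hx.1]
  simp only [e1, e3, Fpot_zero]
  norm_num
  linarith

lemma abs_mom_le (h : IsProfile T v) {E₁ : ℝ} (hE : ∀ t ∈ Set.Icc 0 T, ∀ r, |Phi v t r| ≤ E₁)
    {R t : ℝ} (hR : 0 ≤ R) (ht : t ∈ Set.Icc 0 T) : |mom v R t| ≤ E₁ := by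
  refine le_trans ?_ ((le_abs_self _).trans (hE t ht R))
  refine (intervalIntegral.abs_integral_le_integral_abs hR).trans ?_
  exact intervalIntegral.integral_mono_on hR
    ((continuous_slice (contDiff_mden h.smooth) t).abs.intervalIntegrable _ _)
    ((continuous_slice (contDiff_eden h.smooth) t).intervalIntegrable _ _) (fun x _ => abs_mden_le _)

lemma antitoneOn_mom (h : IsProfile T v) {R₀ : ℝ}
    (hR : ∀ t ∈ Set.Icc 0 T, ∀ r, R₀ ≤ |r| → v (t, r) = 0) (hR0 : 0 < R₀) :
    AntitoneOn (mom v (R₀ + 1)) (Set.Icc 0 T) := by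
  refine antitoneOn_of_hasDerivWithinAt_nonpos (convex_Icc 0 T)
    (fun t _ => (h.hasDerivAt_mom _ t).continuousAt.continuousWithinAt)
    (fun t _ => (h.hasDerivAt_mom _ t).hasDerivWithinAt) (fun t ht => ?_)
  refine (h.deriv_mom_le hR hR0 (interior_subset ht)).trans ?_
  have : 0 ≤ ∫ x in (0:ℝ)..(R₀ + 1), x * (v (t, x) ^ 6 * ell (v (t, x))) :=
    intervalIntegral.integral_nonneg (by linarith) fun x hx => by
      have := ell_pos (v (t, x)); have := hx.1; positivity
  linarith

/-! #### Consequences of a bound on the incoming derivative -/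

lemma inc_add_inc_neg (h : IsProfile T v) {t : ℝ} (ht : t ∈ Set.Icc 0 T) (r : ℝ) :
    inc v (t, r) + inc v (t, -r) = 2 * Dr (rad v) (t, r) := by
  simp only [inc, Dt_rad h.smooth, Dr_rad h.smooth, h.even t ht, h.Dt_even ht, h.Dr_odd ht]
  ring

lemma inc_sub_inc_neg (h : IsProfile T v) {t : ℝ} (ht : t ∈ Set.Icc 0 T) (r : ℝ) :
    inc v (t, r) - inc v (t, -r) = 2 * Dt (rad v) (t, r) := by
  simp only [inc, Dt_rad h.smooth, Dr_rad h.smooth, h.even t ht, h.Dt_even ht, h.Dr_odd ht]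
  ring

lemma abs_rad_sub_le_space (h : IsProfile T v) {t lam : ℝ} (ht : t ∈ Set.Icc 0 T)
    (hl : ∀ r, |inc v (t, r)| ≤ lam) (r r' : ℝ) :
    |rad v (t, r') - rad v (t, r)| ≤ lam * |r' - r| := by
  refine (convex_univ).norm_image_sub_le_of_norm_hasDerivWithin_le (𝕜 := ℝ)
    (f := fun x => rad v (t, x))
    (fun x _ => (hasDerivAt_r h.rad_smooth t x).hasDerivWithinAt) (fun x _ => ?_)
    (Set.mem_univ r) (Set.mem_univ r')
  rw [Real.norm_eq_abs]
  have e := h.inc_add_inc_neg ht x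
  have a1 := abs_le.1 (hl x)
  have a2 := abs_le.1 (hl (-x))
  exact abs_le.2 ⟨by linarith [a1.1, a2.1], by linarith [a1.2, a2.2]⟩

lemma abs_rad_sub_le_time (h : IsProfile T v) {t1 lam : ℝ} (ht1 : t1 ≤ T)
    (hl : ∀ t ∈ Set.Icc 0 t1, ∀ r, |inc v (t, r)| ≤ lam) (r : ℝ) {s s' : ℝ}
    (hs : s ∈ Set.Icc 0 t1) (hs' : s' ∈ Set.Icc 0 t1) :
    |rad v (s', r) - rad v (s, r)| ≤ lam * |s' - s| := by
  refine (convex_Icc 0 t1).norm_image_sub_le_of_norm_hasDerivWithin_le (𝕜 := ℝ)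
    (f := fun x => rad v (x, r))
    (fun x _ => (hasDerivAt_t h.rad_smooth x r).hasDerivWithinAt) (fun x hx => ?_) hs hs'
  rw [Real.norm_eq_abs]
  have e := h.inc_sub_inc_neg ⟨hx.1, hx.2.trans ht1⟩ r
  have a1 := abs_le.1 (hl x hx r)
  have a2 := abs_le.1 (hl x hx (-r))
  exact abs_le.2 ⟨by linarith [a1.1, a2.2], by linarith [a1.2, a2.1]⟩

lemma abs_le_of_inc (h : IsProfile T v) {t lam : ℝ} (ht : t ∈ Set.Icc 0 T)
    (hl : ∀ r, |inc v (t, r)| ≤ lam) (r : ℝ) : |v (t, r)| ≤ lam := by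
  by_cases hr : r = 0
  · subst hr
    have := hl 0
    simpa [inc, Dt_rad h.smooth, Dr_rad h.smooth] using this
  · have h1 := h.abs_rad_sub_le_space ht hl 0 r
    simp only [rad, zero_mul, sub_zero, abs_mul] at h1
    have : 0 < |r| := abs_pos.2 hr
    nlinarith

end IsProfile

end

section

/-! ### Integrating along an incoming characteristic -/

lemma integrable_inv_sq_add_sq {a : ℝ} (ha : 0 < a) :
    Integrable (fun r : ℝ => (a ^ 2 + r ^ 2)⁻¹) ∧ ∫ r : ℝ, (a ^ 2 + r ^ 2)⁻¹ = π / a := by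
  have e : (fun r : ℝ => (a ^ 2 + r ^ 2)⁻¹)
      = fun r : ℝ => (a ^ 2)⁻¹ * (fun x : ℝ => (1 + x ^ 2)⁻¹) (a⁻¹ * r) := by
    funext r
    simp only
    rw [← mul_inv]
    congr 1
    field_simp
  rw [e]
  refine ⟨(integrable_inv_one_add_sq.comp_mul_left' (by positivity)).const_mul _, ?_⟩
  rw [integral_const_mul, Measure.integral_comp_mul_left (fun x : ℝ => (1 + x ^ 2)⁻¹),
    integral_univ_inv_one_add_sq]
  simp only [inv_inv, abs_of_pos ha, smul_eq_mul]
  field_simp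

/-- The singular weight `|r|^(-7/8)` truncated to `|r| ≤ a`. -/
def cutPow (a r : ℝ) : ℝ := (Set.Icc 0 a).indicator (fun x => x ^ (-(7 / 8) : ℝ)) |r|

lemma cutPow_nonneg (a r : ℝ) : 0 ≤ cutPow a r :=
  Set.indicator_nonneg (fun _ hx => Real.rpow_nonneg hx.1 _) _

lemma integrable_cutPow {a : ℝ} (ha : 0 < a) :
    Integrable (cutPow a) ∧ ∫ r, cutPow a r = 16 * a ^ (1 / 8 : ℝ) := by
  have i0 : IntervalIntegrable (fun x : ℝ => x ^ (-(7 / 8) : ℝ)) volume 0 a :=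
    intervalIntegral.intervalIntegrable_rpow' (by norm_num)
  have i1 : IntegrableOn (fun x : ℝ => x ^ (-(7 / 8) : ℝ)) (Set.Ioc 0 a) :=
    (intervalIntegrable_iff_integrableOn_Ioc_of_le ha.le).1 i0
  have e : ∀ x ∈ Set.Ioi (0:ℝ), (Set.Icc 0 a).indicator (fun x : ℝ => x ^ (-(7 / 8) : ℝ)) x
      = (Set.Ioc 0 a).indicator (fun x : ℝ => x ^ (-(7 / 8) : ℝ)) x := by
    intro x hx
    have : x ∈ Set.Icc 0 a ↔ x ∈ Set.Ioc 0 a := ⟨fun h => ⟨hx, h.2⟩, fun h => ⟨h.1.le, h.2⟩⟩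
    by_cases hxa : x ∈ Set.Ioc 0 a
    · rw [Set.indicator_of_mem hxa, Set.indicator_of_mem (this.2 hxa)]
    · rw [Set.indicator_of_notMem hxa, Set.indicator_of_notMem (fun h => hxa (this.1 h))]
  have i2 : IntegrableOn (fun x => (Set.Icc 0 a).indicator (fun x : ℝ => x ^ (-(7 / 8) : ℝ)) x)
      (Set.Ioi 0) :=
    ((integrable_indicator_iff measurableSet_Ioc).2 i1).integrableOn.congr_fun
      (fun x hx => (e x hx).symm) measurableSet_Ioi
  refine ⟨(integrable_fun_norm_addHaar (E := ℝ) volume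
    (f := (Set.Icc 0 a).indicator (fun x : ℝ => x ^ (-(7 / 8) : ℝ)))).2 (by simpa using i2), ?_⟩
  unfold cutPow
  rw [integral_comp_abs (f := (Set.Icc 0 a).indicator (fun x : ℝ => x ^ (-(7 / 8) : ℝ))),
    setIntegral_congr_fun measurableSet_Ioi e, setIntegral_indicator measurableSet_Ioc,
    Set.inter_eq_self_of_subset_right (fun _ hx => hx.1),
    ← intervalIntegral.integral_of_le ha.le, integral_rpow (Or.inl (by norm_num))]
  norm_num
  ring

lemma mul_pow_five_le {a r m ρ : ℝ} (ha : 0 ≤ a) (hr : 0 ≤ r) (ham : a ≤ m)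
    (hra : r * a ≤ ρ * m) (hm : 0 < m) (hρ : 0 < ρ) :
    r * a ^ 5 ≤ 2 * ρ ^ 3 * m ^ 5 * (ρ ^ 2 + r ^ 2)⁻¹ := by
  rw [← div_eq_mul_inv, le_div_iff₀ (by positivity)]
  have h1 : r * a * a ^ 4 ≤ ρ * m * m ^ 4 := by gcongr
  have h2 : (r * a) ^ 3 * a ^ 2 ≤ (ρ * m) ^ 3 * m ^ 2 := by gcongr
  nlinarith [mul_le_mul_of_nonneg_right h1 (sq_nonneg ρ)]

lemma le_mul_rpow_of_pow_le {q r Q : ℝ} (hr : 0 < r) (h : q ^ 8 * r ^ 7 ≤ Q) :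
    q ≤ Q ^ (1 / 8 : ℝ) * r ^ (-(7 / 8) : ℝ) := by
  have hQ : 0 ≤ Q := le_trans (by positivity) h
  refine le_of_pow_le_pow_left₀ (n := 8) (by norm_num) (by positivity) ?_
  rw [mul_pow, ← Real.rpow_natCast (Q ^ (1 / 8 : ℝ)), ← Real.rpow_mul hQ,
    ← Real.rpow_natCast (r ^ (-(7 / 8) : ℝ)), ← Real.rpow_mul hr.le]
  norm_num
  rw [← div_eq_mul_inv, le_div_iff₀ (by positivity)]
  exact h

/-- The nonlinear forcing is controlled by the flux density and two integrable weights, away from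
points where the solution is large on a comparatively large scale. -/
lemma forcing_le {r y τ σ lam K : ℝ} (hτ : 0 < τ) (hσ : 0 < σ) (hl : 0 < lam)
    (hy : |y| ≤ lam) (hK : 0 ≤ K) (hbad : σ * lam < |y| → |y| ^ 8 * ell y * |r| ^ 3 ≤ K) :
    |r * nonlin y| ≤ 12 / τ * (r ^ 2 * Fpot y)
      + (2 * (τ / (σ * lam)) ^ 3 * (σ * lam) ^ 5 * ell lam * ((τ / (σ * lam)) ^ 2 + r ^ 2)⁻¹
      + (K ^ 5 * ell lam ^ 3) ^ (1 / 8 : ℝ) * cutPow (τ / (σ * lam)) r) := by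
  have hL := ell_pos lam
  have hy' : ell y ≤ ell lam := ell_le_ell (by rwa [abs_of_pos hl])
  have hely := ell_pos y
  have hF := le_Fpot y
  have hF0 := Fpot_nonneg y
  have hm : 0 < σ * lam := by positivity
  set ρ := τ / (σ * lam) with hρ
  have hρ0 : 0 < ρ := by positivity
  have hρm : ρ * (σ * lam) = τ := by rw [hρ]; field_simp
  have hcut := cutPow_nonneg ρ r
  have ha := abs_nonneg y
  have hra := abs_nonneg r
  have n1 : 0 ≤ 12 / τ * (r ^ 2 * Fpot y) := by positivity
  have n2 : 0 ≤ 2 * ρ ^ 3 * (σ * lam) ^ 5 * ell lam * (ρ ^ 2 + r ^ 2)⁻¹ := by positivity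
  have n3 : 0 ≤ (K ^ 5 * ell lam ^ 3) ^ (1 / 8 : ℝ) * cutPow ρ r := by positivity
  have e0 : |r * nonlin y| = |r| * |y| ^ 5 * ell y := by
    rw [nonlin_eq, abs_mul, abs_mul, abs_pow, abs_of_pos hely, mul_assoc]
  rw [e0]
  rcases le_or_gt τ (|r| * |y|) with h1 | h1
  · have : |r| * |y| ^ 5 * ell y ≤ 12 / τ * (r ^ 2 * Fpot y) := by
      rw [div_mul_eq_mul_div, le_div_iff₀ hτ]
      calc |r| * |y| ^ 5 * ell y * τ ≤ |r| * |y| ^ 5 * ell y * (|r| * |y|) := by gcongr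
        _ = r ^ 2 * (y ^ 6 * ell y) := by
          rw [← sq_abs r, show y ^ 6 = |y| ^ 6 from ((Even.pow_abs (by decide) y)).symm]; ring
        _ ≤ 12 * (r ^ 2 * Fpot y) := by nlinarith [sq_nonneg r]
    linarith
  rcases le_or_gt |y| (σ * lam) with h2 | h2
  · have := mul_pow_five_le ha hra h2 (by rw [hρm]; exact h1.le) hm hρ0
    rw [sq_abs] at this
    have h3 : |r| * |y| ^ 5 * ell y
        ≤ 2 * ρ ^ 3 * (σ * lam) ^ 5 * (ρ ^ 2 + r ^ 2)⁻¹ * ell lam := by gcongr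
    linarith
  · have h3 := hbad h2
    have hrρ : |r| ≤ ρ := by
      rw [← hρm] at h1
      by_contra hc
      push Not at hc
      exact absurd h1 (not_lt.2 (mul_le_mul hc.le h2.le hm.le hra))
    rcases hra.eq_or_lt with h0 | h0
    · rw [← h0]; linarith
    have h4 : |r| * |y| ^ 5 * ell y
        ≤ (K ^ 5 * ell lam ^ 3) ^ (1 / 8 : ℝ) * cutPow ρ r := by
      rw [cutPow, Set.indicator_of_mem (Set.mem_Icc.2 ⟨hra, hrρ⟩)]
      refine le_mul_rpow_of_pow_le h0 ?_
      calc (|r| * |y| ^ 5 * ell y) ^ 8 * |r| ^ 7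
          = (|y| ^ 8 * ell y * |r| ^ 3) ^ 5 * ell y ^ 3 := by ring
        _ ≤ K ^ 5 * ell lam ^ 3 := by gcongr
    linarith

lemma integral_comp_sub_le {G : ℝ → ℝ} (hG : Integrable G) (h0 : ∀ x, 0 ≤ G x) {t0 t1 : ℝ}
    (h : t0 ≤ t1) (ξ : ℝ) :
    IntervalIntegrable (fun s => G (ξ + -1 * s)) volume t0 t1 ∧
      ∫ s in t0..t1, G (ξ + -1 * s) ≤ ∫ x, G x := by
  have e : (fun s => G (ξ + -1 * s)) = fun s => G (ξ - s) := by funext s; congr 1; ring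
  have hi : Integrable fun s => G (ξ - s) := hG.comp_sub_left ξ
  rw [e]
  refine ⟨hi.intervalIntegrable, ?_⟩
  rw [intervalIntegral.integral_of_le h, ← integral_sub_left_eq_self G volume ξ]
  exact setIntegral_le_integral hi (Filter.Eventually.of_forall fun x => h0 _)

lemma abs_sub_le_of_abs_deriv_le {g g' B : ℝ → ℝ} {t0 t1 : ℝ} (h : t0 ≤ t1)
    (hg : ∀ t ∈ Set.Icc t0 t1, HasDerivAt g (g' t) t) (hc : Continuous g')
    (hB : IntervalIntegrable B volume t0 t1) (hle : ∀ t ∈ Set.Icc t0 t1, |g' t| ≤ B t) :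
    |g t1 - g t0| ≤ ∫ t in t0..t1, B t := by
  rw [← intervalIntegral.integral_eq_sub_of_hasDerivAt
    (fun t ht => hg t (by rwa [Set.uIcc_of_le h] at ht)) (hc.intervalIntegrable _ _)]
  refine (intervalIntegral.abs_integral_le_integral_abs h).trans ?_
  exact intervalIntegral.integral_mono_on h (hc.abs.intervalIntegrable _ _) hB hle

namespace IsProfile

variable {T : ℝ} {v : ℝ × ℝ → ℝ}

lemma exists_large_point (h : IsProfile T v) {E₁ : ℝ}
    (hE : ∀ t ∈ Set.Icc 0 T, ∀ r, |Phi v t r| ≤ E₁) (hE0 : 0 < E₁) {σ κ lam : ℝ} (hσ : 0 < σ)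
    (hκ : 0 < κ) (hl : 0 < lam) (ha : 64 * 192 ^ 2 * E₁ ^ 2 * σ ^ 3 * ell lam ≤ 1)
    (hb : 2 ^ 56 * 192 * E₁ * κ ^ 5 * ell lam ^ 3 ≤ σ) {t0 t1 : ℝ} (h0 : 0 ≤ t0) (h01 : t0 ≤ t1)
    (h1 : t1 ≤ T) (hv : ∀ s ∈ Set.Icc t0 t1, ∀ r, |v (s, r)| ≤ lam)
    (hi0 : ∀ r, |inc v (t0, r)| ≤ lam / 2) {ρ : ℝ} (hi1 : lam ≤ |inc v (t1, ρ)|) :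
    ∃ s ∈ Set.Icc t0 t1, ∃ r, 0 < r ∧ σ * lam < |v (s, r)| ∧
      κ * lam ^ 2 < |v (s, r)| ^ 8 * ell (v (s, r)) * r ^ 3 := by
  by_contra hcon
  push Not at hcon
  have hL := ell_pos lam
  have hsub : ∀ t ∈ Set.Icc t0 t1, t ∈ Set.Icc 0 T := fun t ht => ⟨h0.trans ht.1, ht.2.trans h1⟩
  have hcon' : ∀ s ∈ Set.Icc t0 t1, ∀ r, σ * lam < |v (s, r)| →
      |v (s, r)| ^ 8 * ell (v (s, r)) * |r| ^ 3 ≤ κ * lam ^ 2 := by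
    intro s hs r hr
    rcases lt_trichotomy r 0 with hr0 | hr0 | hr0
    · have := hcon s hs (-r) (by linarith)
      rw [h.even s (hsub s hs)] at this
      rw [abs_of_neg hr0]
      exact this hr
    · subst hr0; simp; positivity
    · rw [abs_of_pos hr0]; exact hcon s hs r hr0 hr
  set τ := 192 * E₁ / lam with hτ
  have hτ0 : 0 < τ := by positivity
  set a := τ / (σ * lam) with haa
  have ha0 : 0 < a := by positivity
  obtain ⟨I1, J1⟩ := integrable_inv_sq_add_sq ha0
  obtain ⟨I2, J2⟩ := integrable_cutPow ha0
  set c1 := 2 * a ^ 3 * (σ * lam) ^ 5 * ell lam with hc1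
  set c2 := ((κ * lam ^ 2) ^ 5 * ell lam ^ 3) ^ (1 / 8 : ℝ) with hc2
  set G : ℝ → ℝ := fun r => c1 * (a ^ 2 + r ^ 2)⁻¹ + c2 * cutPow a r with hG
  have hGi : Integrable G := (I1.const_mul c1).add (I2.const_mul c2)
  have hG0 : ∀ x, 0 ≤ G x := fun x => by
    have := cutPow_nonneg a x
    simp only [hG, hc1, hc2]
    positivity
  have hGint : ∫ x, G x ≤ lam / 4 := by
    have e : ∫ x, G x = c1 * (π / a) + c2 * (16 * a ^ (1 / 8 : ℝ)) := by
      rw [← J1, ← J2, ← integral_const_mul, ← integral_const_mul]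
      exact integral_add (I1.const_mul c1) (I2.const_mul c2)
    have b1 : c1 * (π / a) ≤ lam / 8 := by
      have : c1 * (π / a) = π / 32 * lam * (64 * 192 ^ 2 * E₁ ^ 2 * σ ^ 3 * ell lam) := by
        rw [hc1, haa, hτ]; field_simp; ring
      rw [this]
      have hp := Real.pi_le_four
      have hp0 := Real.pi_pos
      calc π / 32 * lam * (64 * 192 ^ 2 * E₁ ^ 2 * σ ^ 3 * ell lam) ≤ π / 32 * lam * 1 := by gcongr
        _ ≤ lam / 8 := by nlinarith
    have b2 : c2 * (16 * a ^ (1 / 8 : ℝ)) ≤ lam / 8 := by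
      have hQ : 0 ≤ (κ * lam ^ 2) ^ 5 * ell lam ^ 3 := by positivity
      have : c2 * a ^ (1 / 8 : ℝ) ≤ lam / 128 := by
        rw [hc2, ← Real.mul_rpow hQ ha0.le]
        refine le_of_pow_le_pow_left₀ (n := 8) (by norm_num) (by positivity) ?_
        rw [← Real.rpow_natCast, ← Real.rpow_mul (by positivity)]
        norm_num
        rw [haa, hτ]
        have : (κ * lam ^ 2) ^ 5 * ell lam ^ 3 * (192 * E₁ / lam / (σ * lam))
            = (2 ^ 56 * 192 * E₁ * κ ^ 5 * ell lam ^ 3) * (lam ^ 8 / 2 ^ 56 / σ) := by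
          field_simp
        rw [this]
        calc _ ≤ σ * (lam ^ 8 / 2 ^ 56 / σ) := by gcongr
          _ = (lam / 128) ^ 8 := by field_simp; norm_num
      linarith
    rw [e]; linarith
  obtain ⟨K1, K2⟩ := integral_comp_sub_le hGi hG0 h01 (t1 + ρ)
  have hflux := h.flux hE h0 h01 h1 (t1 + ρ)
  have cF := contDiff_Fpot.continuous
  have cn := contDiff_nonlin.continuous
  have cv := h.smooth.continuous
  have hFi : IntervalIntegrable (fun s => 12 / τ * ((t1 + ρ + -1 * s) ^ 2
      * Fpot (v (s, t1 + ρ + -1 * s)))) volume t0 t1 := by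
    refine Continuous.intervalIntegrable ?_ _ _
    fun_prop
  have key := abs_sub_le_of_abs_deriv_le (g := fun s => inc v (s, t1 + ρ + -1 * s)) h01
    (fun t ht => h.inc_line (hsub t ht) (t1 + ρ)) (by fun_prop) (hFi.add K1) (fun s hs => by
      rw [abs_neg]
      have := forcing_le (r := t1 + ρ + -1 * s) (y := v (s, t1 + ρ + -1 * s)) (K := κ * lam ^ 2)
        hτ0 hσ hl (hv s hs _) (by positivity) (hcon' s hs _)
      exact this)
  rw [intervalIntegral.integral_add hFi K1, intervalIntegral.integral_const_mul] at key
  have b0 : 12 / τ * (2 * E₁) = lam / 8 := by rw [hτ]; field_simp; norm_num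
  have b1 : 12 / τ * ∫ s in t0..t1, (t1 + ρ + -1 * s) ^ 2 * Fpot (v (s, t1 + ρ + -1 * s))
      ≤ 12 / τ * (2 * E₁) := by gcongr
  have e1 : t1 + ρ + -1 * t1 = ρ := by ring
  rw [e1] at key
  have := abs_sub_abs_le_abs_sub (inc v (t1, ρ)) (inc v (t0, t1 + ρ + -1 * t0))
  have := hi0 (t1 + ρ + -1 * t0)
  linarith

end IsProfile

end

section

/-! ### Loss of momentum -/

namespace IsProfile

variable {T : ℝ} {v : ℝ × ℝ → ℝ}

/-- A large value of the solution at `(s, r)` forces a large value on a box. -/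
lemma large_box (h : IsProfile T v) {s1 lam : ℝ} (hs1 : s1 ≤ T) (hlam : 0 < lam)
    (hl : ∀ t ∈ Set.Icc 0 s1, ∀ r, |inc v (t, r)| ≤ lam) {s r δ : ℝ} (hs : s ∈ Set.Icc 0 s1)
    (hr : 0 < r) (hδ : δ = |v (s, r)| * r / (4 * lam)) {t x : ℝ} (ht : t ∈ Set.Icc 0 s)
    (htδ : s - δ ≤ t) (hx : r ≤ x) (hxδ : x ≤ r + δ) :
    2 / 5 * |v (s, r)| ≤ |v (t, x)| := by
  have hy : |v (s, r)| ≤ lam := h.abs_le_of_inc ⟨hs.1, hs.2.trans hs1⟩ (hl s hs) r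
  have hy0 := abs_nonneg (v (s, r))
  have hld : lam * δ = |v (s, r)| * r / 4 := by rw [hδ]; field_simp
  have hδr : δ ≤ r / 4 := by
    rw [hδ, div_le_iff₀ (by positivity)]; nlinarith
  have a1 := h.abs_rad_sub_le_time hs1 hl x hs ⟨ht.1, ht.2.trans hs.2⟩
  have a2 := h.abs_rad_sub_le_space ⟨hs.1, hs.2.trans hs1⟩ (hl s hs) r x
  rw [abs_of_nonpos (sub_nonpos.2 ht.2)] at a1
  rw [abs_of_nonneg (sub_nonneg.2 hx)] at a2
  have b1 : lam * -(t - s) ≤ lam * δ := by gcongr; linarith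
  have b2 : lam * (x - r) ≤ lam * δ := by gcongr; linarith
  have c1 := abs_sub_abs_le_abs_sub (rad v (s, x)) (rad v (t, x))
  have c2 := abs_sub_abs_le_abs_sub (rad v (s, r)) (rad v (s, x))
  rw [abs_sub_comm] at c1 c2
  have c3 : |v (s, r)| * r / 2 ≤ |rad v (t, x)| := by
    have : |rad v (s, r)| = |v (s, r)| * r := by
      simp only [rad, abs_mul, abs_of_pos hr]; ring
    linarith
  simp only [rad, abs_mul, abs_of_pos (hr.trans_le hx)] at c3
  have c4 := abs_nonneg (v (t, x))
  nlinarith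

lemma mom_drop (h : IsProfile T v) {R₀ : ℝ}
    (hR : ∀ t ∈ Set.Icc 0 T, ∀ r, R₀ ≤ |r| → v (t, r) = 0) (hR0 : 0 < R₀) {σ κ lam t0 s r : ℝ}
    (hσ : 0 < σ) (hlam : 0 < lam) (hl : ∀ t ∈ Set.Icc 0 s, ∀ r, |inc v (t, r)| ≤ lam)
    (h0 : 0 ≤ t0) (h0s : t0 ≤ s) (hs1 : s ≤ T) (hv0 : ∀ r, |v (t0, r)| ≤ σ * lam / 4)
    (hr : 0 < r) (hbig : σ * lam < |v (s, r)|)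
    (hK : κ * lam ^ 2 < |v (s, r)| ^ 8 * ell (v (s, r)) * r ^ 3) :
    κ / 491520 ≤ mom v (R₀ + 1) t0 - mom v (R₀ + 1) s := by
  have hs : s ∈ Set.Icc 0 s := ⟨h0.trans h0s, le_rfl⟩
  set δ := |v (s, r)| * r / (4 * lam) with hδ
  have hy0 : 0 < |v (s, r)| := lt_trans (by positivity) hbig
  have hδ0 : 0 < δ := by positivity
  have hbox := fun {t x : ℝ} => h.large_box (t := t) (x := x) hs1 hlam hl hs hr hδ
  have hst : t0 ≤ s - δ := by
    by_contra hc
    push Not at hc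
    have := hbox ⟨h0, h0s⟩ hc.le le_rfl (by linarith)
    linarith [hv0 r]
  have hrR : r + δ ≤ R₀ := by
    by_contra hc
    push Not at hc
    have := hbox hs (by linarith) (by linarith) le_rfl
    rw [hR s ⟨hs.1, hs1⟩ (r + δ) (by rw [abs_of_pos (by linarith)]; exact hc.le)] at this
    simp only [abs_zero] at this
    linarith
  set c := r * ((|v (s, r)| / 4) ^ 6 * (ell (v (s, r)) / 5)) with hc
  have cv := h.smooth.continuous
  have ce := contDiff_ell.continuous
  have hint : ∀ t ∈ Set.Icc (s - δ) s,
      δ * c ≤ ∫ x in (0:ℝ)..(R₀ + 1), x * (v (t, x) ^ 6 * ell (v (t, x))) := by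
    intro t ht
    have ht' : t ∈ Set.Icc 0 s := ⟨by linarith [ht.1], ht.2⟩
    have cc : Continuous fun x => x * (v (t, x) ^ 6 * ell (v (t, x))) := by fun_prop
    have i1 : δ * c = ∫ x in r..(r + δ), c := by
      rw [intervalIntegral.integral_const, smul_eq_mul, add_sub_cancel_left]
    rw [i1]
    refine (intervalIntegral.integral_mono_on (by linarith) (by simp) (cc.intervalIntegrable _ _)
      (fun x hx => ?_)).trans (intervalIntegral.integral_mono_interval hr.le (by linarith)
        (by linarith) ?_ (cc.intervalIntegrable _ _))
    · have hb := hbox ht' ht.1 hx.1 hx.2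
      have he := ell_quarter (v (s, r)) (v (t, x)) (by linarith)
      have he0 := ell_pos (v (s, r))
      have hx0 : 0 ≤ x := hr.le.trans hx.1
      rw [hc, show v (t, x) ^ 6 = |v (t, x)| ^ 6 from ((Even.pow_abs (by decide) _)).symm]
      have e1 := hx.1
      gcongr
      · linarith
      · linarith
    · refine (ae_restrict_iff' measurableSet_Ioc).2 (Filter.Eventually.of_forall fun x hx => ?_)
      have := ell_pos (v (t, x))
      have := hx.1
      simp only [Pi.zero_apply]
      positivity
  have key := integral_le_sub_of_deriv_le (f := fun t => -mom v (R₀ + 1) t)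
    (g := fun _ => 2 / 3 * (δ * c)) (a := s - δ) (b := s) (by linarith)
    (fun t _ => (h.hasDerivAt_mom _ t).neg) continuousOn_const (fun t ht => by
      have ht' : t ∈ Set.Icc 0 T := ⟨by linarith [ht.1], ht.2.trans hs1⟩
      linarith [h.deriv_mom_le hR hR0 ht', hint t ht])
  rw [intervalIntegral.integral_const, smul_eq_mul] at key
  have hanti := h.antitoneOn_mom hR hR0 ⟨h0, h0s.trans hs1⟩ (b := s - δ)
    ⟨h0.trans hst, by linarith⟩ hst
  have e : (s - (s - δ)) * (2 / 3 * (δ * c))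
      = (|v (s, r)| ^ 8 * ell (v (s, r)) * r ^ 3) / lam ^ 2 / 491520 := by
    rw [hc, hδ]; field_simp; ring
  have : κ ≤ (|v (s, r)| ^ 8 * ell (v (s, r)) * r ^ 3) / lam ^ 2 := by
    rw [le_div_iff₀ (by positivity)]; exact hK.le
  linarith

end IsProfile

end

section

/-! ### Counting the doublings of the incoming derivative -/

namespace IsProfile

variable {T : ℝ} {v : ℝ × ℝ → ℝ}

lemma inc_eq_zero_outside (h : IsProfile T v) {R₀ : ℝ}
    (hR : ∀ t ∈ Set.Icc 0 T, ∀ r, R₀ ≤ |r| → v (t, r) = 0) {t r : ℝ}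
    (ht : t ∈ Set.Icc 0 T) (hr : R₀ < |r|) : inc v (t, r) = 0 := by
  have main : ∀ x, R₀ < x → inc v (t, x) = 0 ∧ inc v (t, -x) = 0 := by
    intro x hx
    have e := h.eden_eq_zero_outside hR ht hx
    have hF := Fpot_nonneg (v (t, x))
    simp only [eden] at e
    have p : 0 ≤ x ^ 2 * Fpot (v (t, x)) := by positivity
    have e1 : Dt (rad v) (t, x) = 0 := by
      refine pow_eq_zero_iff (n := 2) (by norm_num) |>.1 ?_
      nlinarith [sq_nonneg (Dt (rad v) (t, x)), sq_nonneg (Dr (rad v) (t, x))]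
    have e2 : Dr (rad v) (t, x) = 0 := by
      refine pow_eq_zero_iff (n := 2) (by norm_num) |>.1 ?_
      nlinarith [sq_nonneg (Dt (rad v) (t, x)), sq_nonneg (Dr (rad v) (t, x))]
    have e3 : inc v (t, x) = 0 := by simp [inc, e1, e2]
    have := h.inc_add_inc_neg ht x
    exact ⟨e3, by rw [e2, e3] at this; linarith⟩
  rcases lt_abs.1 hr with h1 | h1
  · exact (main r h1).1
  · simpa using (main (-r) h1).2

/-- The first time at which the incoming derivative reaches a given size. -/
lemma exists_first_time (h : IsProfile T v) {R₀ : ℝ}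
    (hR : ∀ t ∈ Set.Icc 0 T, ∀ r, R₀ ≤ |r| → v (t, r) = 0) {M₀ lam : ℝ}
    (hM : ∀ r, |inc v (0, r)| ≤ M₀) (hlam : 0 < lam) (hMl : M₀ ≤ lam) {t : ℝ}
    (ht : t ∈ Set.Icc 0 T) (hr : ∃ r, lam ≤ |inc v (t, r)|) :
    ∃ t0 ∈ Set.Icc 0 t, (∀ s ∈ Set.Icc 0 t0, ∀ r, |inc v (s, r)| ≤ lam) ∧
      ∃ r, lam ≤ |inc v (t0, r)| := by
  have hc : Continuous fun z => |inc v z| := (contDiff_inc h.smooth).continuous.abs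
  have hin : ∀ s ∈ Set.Icc 0 T, ∀ r, lam ≤ |inc v (s, r)| → r ∈ Set.Icc (-R₀) R₀ := by
    intro s hs r hr
    by_contra hcon
    rw [Set.mem_Icc, ← abs_le, not_le] at hcon
    rw [h.inc_eq_zero_outside hR hs hcon, abs_zero] at hr
    linarith
  let A : Set (ℝ × ℝ) := (Set.Icc 0 t ×ˢ Set.Icc (-R₀) R₀) ∩ {z | lam ≤ |inc v z|}
  have hA : IsCompact A :=
    (isCompact_Icc.prod isCompact_Icc).inter_right (isClosed_le continuous_const hc)
  have hne : A.Nonempty := by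
    obtain ⟨r, hr⟩ := hr
    exact ⟨(t, r), ⟨⟨⟨ht.1, le_rfl⟩, hin t ht r hr⟩, hr⟩⟩
  obtain ⟨⟨t0, r0⟩, hz, hmin⟩ := hA.exists_isMinOn hne continuous_fst.continuousOn
  have ht0 : t0 ∈ Set.Icc 0 t := hz.1.1
  have hlt : ∀ s ∈ Set.Ico 0 t0, ∀ r, |inc v (s, r)| ≤ lam := by
    intro s hs r
    by_contra hcon
    push Not at hcon
    have hsT : s ∈ Set.Icc 0 T := ⟨hs.1, hs.2.le.trans (ht0.2.trans ht.2)⟩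
    have : (s, r) ∈ A := ⟨⟨⟨hs.1, hs.2.le.trans ht0.2⟩, hin s hsT r hcon.le⟩, hcon.le⟩
    exact absurd (hmin this) (not_le.2 hs.2)
  refine ⟨t0, ht0, fun s hs r => ?_, r0, hz.2⟩
  rcases ht0.1.eq_or_lt with h0 | h0
  · have : s = 0 := le_antisymm (by rw [h0]; exact hs.2) hs.1
    rw [this]; exact (hM r).trans hMl
  · refine le_on_closure (s := Set.Ico 0 t0) (f := fun s => |inc v (s, r)|) (g := fun _ => lam)
      (fun x hx => hlt x hx r) ?_ continuousOn_const (by rw [closure_Ico h0.ne]; exact hs)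
    exact (hc.comp (by fun_prop : Continuous fun s : ℝ => (s, r))).continuousOn

lemma nat_mul_le_mom_drop (h : IsProfile T v) {R₀ : ℝ}
    (hR : ∀ t ∈ Set.Icc 0 T, ∀ r, R₀ ≤ |r| → v (t, r) = 0) (hR0 : 0 < R₀) {E₁ : ℝ}
    (hE : ∀ t ∈ Set.Icc 0 T, ∀ r, |Phi v t r| ≤ E₁) (hE0 : 0 < E₁) {M₀ : ℝ} (hM0 : 0 < M₀)
    (hM : ∀ r, |inc v (0, r)| ≤ M₀) {σ κ Λ B : ℝ} (hσ : 0 < σ) (hκ : 0 < κ)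
    (ha : 64 * 192 ^ 2 * E₁ ^ 2 * σ ^ 3 * ell Λ ≤ 1)
    (hb : 2 ^ 56 * 192 * E₁ * κ ^ 5 * ell Λ ^ 3 ≤ σ) (hB : 2 ≤ B) (hBσ : 4 ≤ σ * B) (k : ℕ) :
    M₀ * B ^ k ≤ Λ → ∀ t ∈ Set.Icc 0 T, (∃ r, M₀ * B ^ k ≤ |inc v (t, r)|) →
      k * (κ / 491520) ≤ mom v (R₀ + 1) 0 - mom v (R₀ + 1) t := by
  have hT0 : (0:ℝ) ∈ Set.Icc 0 T := ⟨le_rfl, h.pos.le⟩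
  induction k with
  | zero =>
    intro _ t ht _
    have := h.antitoneOn_mom hR hR0 hT0 ht ht.1
    simpa using this
  | succ k ih =>
    intro hΛ t ht hr
    have hB0 : 0 < B := by linarith
    set μ := M₀ * B ^ k with hμ
    have hμ0 : 0 < μ := by positivity
    have hlam : M₀ * B ^ (k + 1) = μ * B := by rw [hμ]; ring
    rw [hlam] at hΛ hr
    have hμl : μ ≤ μ * B := by nlinarith
    have hMμ : M₀ ≤ μ := by
      have : 1 ≤ B ^ k := one_le_pow₀ (by linarith)
      rw [hμ]; nlinarith
    have hl0 : 0 < μ * B := by positivity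
    obtain ⟨t1, ht1, hle1, ρ, hρ⟩ :=
      h.exists_first_time hR hM hl0 (hMμ.trans hμl) ht hr
    have ht1' : t1 ∈ Set.Icc 0 T := ⟨ht1.1, ht1.2.trans ht.2⟩
    obtain ⟨t0, ht0, hle0, hat0⟩ :=
      h.exists_first_time hR hM hμ0 hMμ ht1' ⟨ρ, hμl.trans hρ⟩
    have ht0' : t0 ∈ Set.Icc 0 T := ⟨ht0.1, ht0.2.trans ht1'.2⟩
    have hprev := ih (hμl.trans hΛ) t0 ht0' hat0
    have hell : ell (μ * B) ≤ ell Λ :=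
      ell_le_ell (by rw [abs_of_pos hl0, abs_of_pos (hl0.trans_le hΛ)]; exact hΛ)
    have hell0 := ell_pos (μ * B)
    have ha' : 64 * 192 ^ 2 * E₁ ^ 2 * σ ^ 3 * ell (μ * B) ≤ 1 := le_trans (by gcongr) ha
    have hb' : 2 ^ 56 * 192 * E₁ * κ ^ 5 * ell (μ * B) ^ 3 ≤ σ := le_trans (by gcongr) hb
    have hat : ∀ r, |inc v (t0, r)| ≤ μ := hle0 t0 ⟨ht0.1, le_rfl⟩
    obtain ⟨s, hs, r, hr0, hbig, hK⟩ := h.exists_large_point hE hE0 hσ hκ hl0 ha' hb' ht0.1 ht0.2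
      ht1'.2 (fun s hs r => h.abs_le_of_inc ⟨ht0.1.trans hs.1, hs.2.trans ht1'.2⟩
        (hle1 s ⟨ht0.1.trans hs.1, hs.2⟩) r)
      (fun r => (hat r).trans (by nlinarith)) hρ
    have hdrop := h.mom_drop hR hR0 hσ hl0
      (fun x hx => hle1 x ⟨hx.1, hx.2.trans hs.2⟩) ht0.1 hs.1 (hs.2.trans ht1'.2)
      (fun x => (h.abs_le_of_inc ht0' hat x).trans (by nlinarith)) hr0 hbig hK
    have hanti := h.antitoneOn_mom hR hR0 (a := s) (b := t)
      ⟨ht0.1.trans hs.1, hs.2.trans ht1'.2⟩ ht (hs.2.trans ht1.2)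
    push_cast
    linarith

lemma nat_mul_le_of_inc (h : IsProfile T v) {R₀ : ℝ}
    (hR : ∀ t ∈ Set.Icc 0 T, ∀ r, R₀ ≤ |r| → v (t, r) = 0) (hR0 : 0 < R₀) {E₁ : ℝ}
    (hE : ∀ t ∈ Set.Icc 0 T, ∀ r, |Phi v t r| ≤ E₁) (hE0 : 0 < E₁) {M₀ : ℝ} (hM0 : 0 < M₀)
    (hM : ∀ r, |inc v (0, r)| ≤ M₀) {σ κ Λ B : ℝ} (hσ : 0 < σ) (hκ : 0 < κ)
    (ha : 64 * 192 ^ 2 * E₁ ^ 2 * σ ^ 3 * ell Λ ≤ 1)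
    (hb : 2 ^ 56 * 192 * E₁ * κ ^ 5 * ell Λ ^ 3 ≤ σ) (hB : 2 ≤ B) (hBσ : 4 ≤ σ * B) {k : ℕ}
    (hΛ : M₀ * B ^ k ≤ Λ) {t r : ℝ} (ht : t ∈ Set.Icc 0 T) (hr : Λ ≤ |inc v (t, r)|) :
    k * κ ≤ 983040 * E₁ := by
  have h1 := h.nat_mul_le_mom_drop hR hR0 hE hE0 hM0 hM hσ hκ ha hb hB hBσ k hΛ t ht
    ⟨r, hΛ.trans hr⟩
  have h2 := abs_le.1 (h.abs_mom_le hE (R := R₀ + 1) (by linarith) ht)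
  have h3 := abs_le.1 (h.abs_mom_le hE (R := R₀ + 1) (by linarith) ⟨le_rfl, h.pos.le⟩)
  linarith [h2.1, h3.2]

end IsProfile

end

/-! ### Choice of parameters -/

lemma ell_mul_sq_pow_le {M b : ℝ} (hM : 1 ≤ M) (hb : 1 ≤ b) (k : ℕ) :
    ell (M * (b ^ 2) ^ k) ≤ 4 * M + 4 * k * b := by
  have hk : 1 ≤ (b ^ 2) ^ k := one_le_pow₀ (one_le_pow₀ hb)
  have h1 : 1 ≤ M * (b ^ 2) ^ k := by nlinarith
  have e : ell (M * (b ^ 2) ^ k) ≤ Real.log ((2 * M) ^ 2 * b ^ (4 * k)) := by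
    refine Real.log_le_log (by positivity) ?_
    have : (2 * M) ^ 2 * b ^ (4 * k) = 4 * (M * (b ^ 2) ^ k) ^ 2 := by ring
    rw [this]; nlinarith
  rw [Real.log_mul (by positivity) (by positivity), Real.log_pow, Real.log_pow] at e
  push_cast at e
  have l1 := Real.log_le_sub_one_of_pos (show 0 < 2 * M by linarith)
  have l2 := Real.log_le_sub_one_of_pos (show 0 < b by linarith)
  have : (4 * k : ℝ) * Real.log b ≤ 4 * k * b := by gcongr; linarith
  linarith

/-- The parameters of the doubling argument can be chosen in terms of the energy and the size of
the data. -/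
lemma exists_parameters {E₁ M₀ : ℝ} (hE : 0 < E₁) (hM : 0 < M₀) :
    ∃ (Λ σ κ B : ℝ) (k : ℕ), 0 < σ ∧ 0 < κ ∧ 64 * 192 ^ 2 * E₁ ^ 2 * σ ^ 3 * ell Λ ≤ 1 ∧
      2 ^ 56 * 192 * E₁ * κ ^ 5 * ell Λ ^ 3 ≤ σ ∧ 2 ≤ B ∧ 4 ≤ σ * B ∧ M₀ * B ^ k ≤ Λ ∧
      983040 * E₁ < k * κ := by
  obtain ⟨c₁, hc₁⟩ : ∃ c, c = 1 / (4096 * 192 ^ 2 * E₁ ^ 2) := ⟨_, rfl⟩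
  have hc₁0 : 0 < c₁ := by rw [hc₁]; positivity
  obtain ⟨X, hX⟩ : ∃ X, X = 2 ^ 56 * 192 * E₁ * c₁ ^ 3 := ⟨_, rfl⟩
  have hX0 : 0 < X := by rw [hX]; positivity
  obtain ⟨c₃, hc₃⟩ : ∃ c, c = 1 / (1 + X) := ⟨_, rfl⟩
  have hc₃0 : 0 < c₃ := by rw [hc₃]; positivity
  have hXc : X * c₃ ^ 5 ≤ 4 := by
    have h1 : c₃ ≤ 1 := by rw [hc₃, div_le_one (by positivity)]; linarith
    have h2 : c₃ ^ 5 ≤ c₃ := by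
      calc c₃ ^ 5 ≤ c₃ ^ 1 := pow_le_pow_of_le_one hc₃0.le h1 (by norm_num)
        _ = c₃ := pow_one _
    have h3 : X * c₃ ≤ 1 := by
      rw [hc₃, mul_one_div, div_le_one (by positivity)]; linarith
    nlinarith
  obtain ⟨c₄, hc₄⟩ : ∃ c, c = 983040 * E₁ / c₃ := ⟨_, rfl⟩
  have hc₄0 : 0 < c₄ := by rw [hc₄]; positivity
  obtain ⟨b, hb⟩ : ∃ b, b = 2 + (4 * (M₀ + 1) + 4 * c₄ + 8) / c₁ := ⟨_, rfl⟩
  have hb2 : 2 ≤ b := by rw [hb]; linarith [show 0 < (4 * (M₀ + 1) + 4 * c₄ + 8) / c₁ by positivity]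
  have hb0 : 0 < b := by linarith
  have hbc : 4 * (M₀ + 1) + 4 * c₄ + 8 ≤ c₁ * b := by
    rw [← div_le_iff₀' hc₁0, hb]; linarith
  obtain ⟨k, hk⟩ : ∃ k : ℕ, k = ⌈c₄ * b ^ 4⌉₊ + 1 := ⟨_, rfl⟩
  have hk1 : c₄ * b ^ 4 < k := by
    rw [hk]; push_cast
    linarith [Nat.le_ceil (c₄ * b ^ 4)]
  have hk2 : (k : ℝ) ≤ c₄ * b ^ 4 + 2 := by
    rw [hk]; push_cast
    linarith [Nat.ceil_lt_add_one (show 0 ≤ c₄ * b ^ 4 by positivity)]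
  have hell : ell ((M₀ + 1) * (b ^ 2) ^ k) ≤ c₁ * b ^ 6 := by
    have hb5 : 1 ≤ b ^ 5 := one_le_pow₀ (by linarith)
    have hb4 : b ≤ b ^ 5 := by
      calc b = b ^ 1 := (pow_one b).symm
        _ ≤ b ^ 5 := pow_le_pow_right₀ (by linarith) (by norm_num)
    calc ell ((M₀ + 1) * (b ^ 2) ^ k) ≤ 4 * (M₀ + 1) + 4 * k * b :=
          ell_mul_sq_pow_le (by linarith) (by linarith) k
      _ ≤ 4 * (M₀ + 1) + 4 * (c₄ * b ^ 4 + 2) * b := by gcongr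
      _ = 4 * (M₀ + 1) * 1 + 4 * c₄ * b ^ 5 + 8 * b := by ring
      _ ≤ 4 * (M₀ + 1) * b ^ 5 + 4 * c₄ * b ^ 5 + 8 * b ^ 5 := by gcongr
      _ = (4 * (M₀ + 1) + 4 * c₄ + 8) * b ^ 5 := by ring
      _ ≤ c₁ * b * b ^ 5 := by gcongr
      _ = c₁ * b ^ 6 := by ring
  have hell0 := ell_pos ((M₀ + 1) * (b ^ 2) ^ k)
  refine ⟨(M₀ + 1) * (b ^ 2) ^ k, 4 / b ^ 2, c₃ / b ^ 4, b ^ 2, k, by positivity, by positivity,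
    ?_, ?_, by nlinarith, ?_, ?_, ?_⟩
  · calc 64 * 192 ^ 2 * E₁ ^ 2 * (4 / b ^ 2) ^ 3 * ell ((M₀ + 1) * (b ^ 2) ^ k)
        ≤ 64 * 192 ^ 2 * E₁ ^ 2 * (4 / b ^ 2) ^ 3 * (c₁ * b ^ 6) := by gcongr
      _ = 1 := by rw [hc₁]; field_simp; norm_num
  · calc 2 ^ 56 * 192 * E₁ * (c₃ / b ^ 4) ^ 5 * ell ((M₀ + 1) * (b ^ 2) ^ k) ^ 3
        ≤ 2 ^ 56 * 192 * E₁ * (c₃ / b ^ 4) ^ 5 * (c₁ * b ^ 6) ^ 3 := by gcongr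
      _ = X * c₃ ^ 5 / b ^ 2 := by rw [hX]; field_simp
      _ ≤ 4 / b ^ 2 := by gcongr
  · rw [div_mul_cancel₀ _ (by positivity)]
  · gcongr; linarith
  · rw [mul_div_assoc', lt_div_iff₀ (by positivity)]
    calc 983040 * E₁ * b ^ 4 = c₄ * b ^ 4 * c₃ := by rw [hc₄]; field_simp
      _ < k * c₃ := by gcongr

/-- Uniform bound for profiles in terms of the energy and the initial incoming derivative. -/
theorem exists_profile_bound {E₁ M₀ : ℝ} (hE : 0 < E₁) (hM : 0 < M₀) :
    ∃ C : ℝ, ∀ (T : ℝ) (v : ℝ × ℝ → ℝ), IsProfile T v →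
      (∀ t ∈ Set.Icc 0 T, ∃ n : ℕ, ∀ r, (n : ℝ) ≤ r → v (t, r) = 0) →
      (∀ t ∈ Set.Icc 0 T, ∀ r, |Phi v t r| ≤ E₁) → (∀ r, |inc v (0, r)| ≤ M₀) →
      ∀ t ∈ Set.Icc 0 T, ∀ r, |v (t, r)| ≤ C := by
  obtain ⟨Λ, σ, κ, B, k, hσ, hκ, ha, hb, hB, hBσ, hΛ, hk⟩ := exists_parameters hE hM
  refine ⟨Λ, fun T v h hs hPhi hinc t ht r => h.abs_le_of_inc ht (fun ρ => ?_) r⟩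
  obtain ⟨R, hR0, hR⟩ := h.exists_uniform_support hs
  by_contra hcon
  push Not at hcon
  exact absurd (h.nat_mul_le_of_inc hR hR0 hPhi hE hM hinc hσ hκ ha hb hB hBσ hΛ ht hcon.le)
    (not_le.2 hk)

/-! ### Derivatives of radial functions -/

lemma hasFDerivAt_norm {x : Sp} (hx : x ≠ 0) :
    HasFDerivAt (fun y : Sp => ‖y‖) (‖x‖⁻¹ • innerSL ℝ x) x := by
  have h1 := ((hasStrictFDerivAt_norm_sq x).hasFDerivAt).sqrt (by simpa using hx)
  have e : (fun y : Sp => Real.sqrt (‖y‖ ^ 2)) = fun y : Sp => ‖y‖ :=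
    funext fun y => Real.sqrt_sq (norm_nonneg y)
  rw [e] at h1
  refine h1.congr_fderiv ?_
  ext y
  simp only [Real.sqrt_sq (norm_nonneg x), smul_apply, smul_eq_mul]
  have : ‖x‖ ≠ 0 := by simpa using hx
  simp
  field_simp

lemma hasFDerivAt_comp_norm {φ : ℝ → ℝ} {φ' : ℝ} {x : Sp} (hx : x ≠ 0)
    (h : HasDerivAt φ φ' ‖x‖) :
    HasFDerivAt (fun y : Sp => φ ‖y‖) (φ' • (‖x‖⁻¹ • innerSL ℝ x)) x :=
  h.comp_hasFDerivAt x (hasFDerivAt_norm hx)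

lemma innerSL_single (x : Sp) (i : Fin 3) :
    (innerSL ℝ x) (EuclideanSpace.single i (1:ℝ)) = x i := by
  simp [EuclideanSpace.inner_single_right]

lemma pd_comp_norm {φ : ℝ → ℝ} {φ' : ℝ} {x : Sp} (hx : x ≠ 0)
    (h : HasDerivAt φ φ' ‖x‖) (i : Fin 3) :
    pd i (fun y => φ ‖y‖) x = φ' * (x i / ‖x‖) := by
  rw [pd, (hasFDerivAt_comp_norm hx h).fderiv]
  simp only [smul_apply, innerSL_single, smul_eq_mul]
  ring

lemma pd_pd_comp_norm {φ φ' φ'' : ℝ → ℝ} {x : Sp} (hx : x ≠ 0)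
    (h : ∀ r, HasDerivAt φ (φ' r) r) (h' : ∀ r, HasDerivAt φ' (φ'' r) r) (i j : Fin 3) :
    pd i (pd j fun y => φ ‖y‖) x = φ'' ‖x‖ * (x i / ‖x‖ * (x j / ‖x‖))
      + φ' ‖x‖ / ‖x‖ * ((if i = j then 1 else 0) - x i / ‖x‖ * (x j / ‖x‖)) := by
  have hx' : ‖x‖ ≠ 0 := by simpa using hx
  have e : pd j (fun y => φ ‖y‖) =ᶠ[nhds x] fun y => (φ' ‖y‖ / ‖y‖) * y j := by
    filter_upwards [isOpen_ne.mem_nhds hx] with y hy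
    rw [pd_comp_norm hy (h _)]; ring
  have h1 := hasFDerivAt_comp_norm (φ := fun r => φ' r / r) hx ((h' ‖x‖).div (hasDerivAt_id _) hx')
  have h2 : HasFDerivAt (fun y : Sp => y j) (EuclideanSpace.proj (𝕜 := ℝ) j) x :=
    (EuclideanSpace.proj (𝕜 := ℝ) j).hasFDerivAt
  rw [pd, e.fderiv_eq, (h1.fun_mul h2).fderiv]
  have h3 : (EuclideanSpace.proj (𝕜 := ℝ) j) (EuclideanSpace.single i (1:ℝ) : Sp)
      = if i = j then 1 else 0 := by
    by_cases hij : i = j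
    · subst hij; simp
    · simp [hij, Ne.symm hij]
  simp only [add_apply, smul_apply, innerSL_single, smul_eq_mul, h3]
  by_cases hij : i = j
  · simp only [hij, if_true]; field_simp; ring
  · simp only [hij, if_false]; field_simp; ring

lemma sum_sq_div_norm {x : Sp} (hx : x ≠ 0) :
    (x 0 / ‖x‖) ^ 2 + (x 1 / ‖x‖) ^ 2 + (x 2 / ‖x‖) ^ 2 = 1 := by
  have hx' : ‖x‖ ≠ 0 := by simpa using hx
  have := EuclideanSpace.real_norm_sq_eq x
  rw [Fin.sum_univ_three] at this
  field_simp
  linarith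

lemma lap_comp_norm {φ φ' φ'' : ℝ → ℝ} {x : Sp} (hx : x ≠ 0)
    (h : ∀ r, HasDerivAt φ (φ' r) r) (h' : ∀ r, HasDerivAt φ' (φ'' r) r) :
    lap (fun y => φ ‖y‖) x = φ'' ‖x‖ + 2 * (φ' ‖x‖ / ‖x‖) := by
  have hn := sum_sq_div_norm hx
  simp only [lap, Fin.sum_univ_three, pd_pd_comp_norm hx h h', if_true]
  linear_combination (φ'' ‖x‖ - φ' ‖x‖ / ‖x‖) * hn

lemma sum_sq_pd_comp_norm {φ : ℝ → ℝ} {φ' : ℝ} {x : Sp} (hx : x ≠ 0)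
    (h : HasDerivAt φ φ' ‖x‖) : ∑ i, (pd i (fun y => φ ‖y‖) x) ^ 2 = φ' ^ 2 := by
  have hn := sum_sq_div_norm hx
  simp only [Fin.sum_univ_three, pd_comp_norm hx h]
  linear_combination φ' ^ 2 * hn

lemma sum_sq_pd_pd_comp_norm {φ φ' φ'' : ℝ → ℝ} {x : Sp} (hx : x ≠ 0)
    (h : ∀ r, HasDerivAt φ (φ' r) r) (h' : ∀ r, HasDerivAt φ' (φ'' r) r) :
    ∑ i, ∑ j, (pd i (pd j fun y => φ ‖y‖) x) ^ 2
      = φ'' ‖x‖ ^ 2 + 2 * (φ' ‖x‖ / ‖x‖) ^ 2 := by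
  have hn := sum_sq_div_norm hx
  simp only [Fin.sum_univ_three, pd_pd_comp_norm hx h h', if_true, Fin.reduceEq, if_false]
  generalize x 0 / ‖x‖ = p at *
  generalize x 1 / ‖x‖ = q at *
  generalize x 2 / ‖x‖ = r at *
  generalize φ'' ‖x‖ = a
  generalize φ' ‖x‖ / ‖x‖ = b
  linear_combination (a ^ 2 * (p ^ 2 + q ^ 2 + r ^ 2 + 1) - 2 * a * b * (p ^ 2 + q ^ 2 + r ^ 2)
    + b ^ 2 * (p ^ 2 + q ^ 2 + r ^ 2 - 1)) * hn

/-! ### The radial profile of a solution -/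

/-- The radial profile `v(t, r) = u(t, r e₀)`. -/
def prof (u : ℝ → Sp → ℝ) (z : ℝ × ℝ) : ℝ := u z.1 (z.2 • EuclideanSpace.single 0 1)

lemma contDiff_prof {u : ℝ → Sp → ℝ} (h : ContDiff ℝ ∞ fun p : ℝ × Sp => u p.1 p.2) :
    ContDiff ℝ ∞ (prof u) :=
  h.comp (contDiff_fst.prodMk (contDiff_snd.smul contDiff_const))

lemma eq_prof_norm {I : Set ℝ} {u : ℝ → Sp → ℝ} (h : IsRadialSolution I u) {t : ℝ} (ht : t ∈ I)
    (x : Sp) : u t x = prof u (t, ‖x‖) :=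
  h t ht _ _ (by simp [norm_smul])

lemma prof_even {I : Set ℝ} {u : ℝ → Sp → ℝ} (h : IsRadialSolution I u) {t : ℝ} (ht : t ∈ I)
    (r : ℝ) : prof u (t, -r) = prof u (t, r) :=
  h t ht _ _ (by simp [norm_smul])

lemma exists_nat_prof_eq_zero {I : Set ℝ} {u : ℝ → Sp → ℝ} (h : IsClassicalSolution I u) {t : ℝ}
    (ht : t ∈ I) : ∃ n : ℕ, ∀ r, (n : ℝ) ≤ r → prof u (t, r) = 0 := by
  obtain ⟨R, hR⟩ := (h.2.1 t ht).isCompact.isBounded.exists_norm_le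
  obtain ⟨n, hn⟩ := exists_nat_gt R
  refine ⟨n, fun r hr => ?_⟩
  refine image_eq_zero_of_notMem_tsupport (f := u t) (fun hc => ?_)
  have h1 := hR _ hc
  simp only [norm_smul, Real.norm_eq_abs, PiLp.norm_single, abs_one, mul_one] at h1
  linarith [le_abs_self r]

lemma deriv_of_even {φ : ℝ → ℝ} {ε : ℝ} (he : ∀ r, φ (-r) = ε * φ r) {r a b : ℝ}
    (ha : HasDerivAt φ a r) (hb : HasDerivAt φ b (-r)) : b = -ε * a := by
  have h1 : HasDerivAt (fun x => φ (-x)) (b * -1) r := hb.comp r (hasDerivAt_neg r)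
  have h2 : (fun x => φ (-x)) = fun x => ε * φ x := funext he
  rw [h2] at h1
  linarith [h1.unique (ha.const_mul ε)]

lemma isProfile_prof {T : ℝ} (hT : 0 < T) {u : ℝ → Sp → ℝ}
    (hu : IsClassicalSolution (Set.Icc 0 T) u) (hr : IsRadialSolution (Set.Icc 0 T) u) :
    IsProfile T (prof u) := by
  have hs := contDiff_prof hu.1
  have hs1 := contDiff_Dr hs
  have hst := contDiff_Dt hs
  refine ⟨hT, hs, fun t ht r => prof_even hr ht r, fun t ht r => ?_⟩
  have o1 : ∀ r, Dr (prof u) (t, -r) = -1 * Dr (prof u) (t, r) := fun r =>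
    deriv_of_even (φ := fun r => prof u (t, r)) (ε := 1)
      (fun r => by rw [one_mul]; exact prof_even hr ht r)
      (hasDerivAt_r hs t r) (hasDerivAt_r hs t (-r))
  have o2 : ∀ r, Dr (Dr (prof u)) (t, -r) = - -1 * Dr (Dr (prof u)) (t, r) := fun r =>
    deriv_of_even (φ := fun r => Dr (prof u) (t, r)) o1 (hasDerivAt_r hs1 t r)
      (hasDerivAt_r hs1 t (-r))
  have e1 : Dt (rad (prof u)) = rad (Dt (prof u)) := funext fun z => Dt_rad hs z
  have e2 : Dt (Dt (rad (prof u))) (t, r) = r * Dt (Dt (prof u)) (t, r) := by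
    rw [e1, Dt_rad hst]
  have e3 : Dr (Dr (rad (prof u))) (t, r)
      = 2 * Dr (prof u) (t, r) + r * Dr (Dr (prof u)) (t, r) := by
    have f : Dr (rad (prof u)) = fun z => prof u z + rad (Dr (prof u)) z :=
      funext fun z => Dr_rad hs z
    have hc : ContDiff ℝ ∞ fun z => prof u z + rad (Dr (prof u)) z := hs.add (contDiff_rad hs1)
    rw [f, (hasDerivAt_r hc t r).unique ((hasDerivAt_r hs t r).add
      (hasDerivAt_r (contDiff_rad hs1) t r)), Dr_rad hs1]
    ring
  rw [e2, e3]
  rcases eq_or_ne r 0 with h0 | h0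
  · subst h0
    have := o1 0
    simp only [neg_zero] at this
    have h0' : Dr (prof u) (t, 0) = 0 := by linarith
    simp [h0']
  set x : Sp := r • EuclideanSpace.single 0 1 with hx
  have hx0 : x ≠ 0 := by
    rw [hx]; simpa using h0
  have hxn : ‖x‖ = |r| := by simp [hx, norm_smul]
  have eq := hu.2.2 t ht x
  have hd1 : (deriv fun s => u s x) = fun s => Dt (prof u) (s, r) :=
    funext fun s => (hasDerivAt_t hs s r).deriv
  have hut : u t = fun y => prof u (t, ‖y‖) := funext fun y => eq_prof_norm hr ht y
  have hl : lap (u t) x = Dr (Dr (prof u)) (t, r) + 2 * (Dr (prof u) (t, r) / r) := by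
    rw [hut, lap_comp_norm (φ := fun r => prof u (t, r)) hx0 (fun r => hasDerivAt_r hs t r)
      (fun r => hasDerivAt_r hs1 t r), hxn]
    rcases abs_choice r with h | h
    · rw [h]
    · rw [h, o1, o2]; field_simp
  rw [hd1, (hasDerivAt_t hst t r).deriv, hl] at eq
  have eux : u t x = prof u (t, r) := rfl
  rw [eq, eux]
  field_simp
  ring

/-! ### Radial integrals -/

/-- The area of the unit sphere of `ℝ³`, as three times the volume of the unit ball. -/
def sphereArea : ℝ := 3 * volume.real (Metric.ball (0 : Sp) 1)

lemma sphereArea_pos : 0 < sphereArea :=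
  mul_pos (by norm_num) (ENNReal.toReal_pos (Metric.measure_ball_pos volume _ one_pos).ne'
    measure_ball_lt_top.ne)

lemma integral_comp_norm {φ : ℝ → ℝ} {R : ℝ} (hR : 0 ≤ R) (h : ∀ r, R < r → φ r = 0) :
    ∫ x : Sp, φ ‖x‖ = sphereArea * ∫ y in (0:ℝ)..R, y ^ 2 * φ y := by
  rw [integral_fun_norm_addHaar, intervalIntegral.integral_of_le hR,
    ← setIntegral_eq_of_subset_of_forall_sdiff_eq_zero (μ := volume) (s := Set.Ioc 0 R)
      (t := Set.Ioi 0) (f := fun y => y ^ 2 * φ y) measurableSet_Ioi (fun x hx => hx.1)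
      (fun x hx => ?_)]
  · simp [sphereArea, mul_assoc]
  · have : R < x := by
      by_contra hc
      exact hx.2 ⟨hx.1, not_lt.1 hc⟩
    simp [h x this]

lemma integral_eq_of_comp_norm {f : Sp → ℝ} {φ : ℝ → ℝ} {R : ℝ} (hR : 0 ≤ R)
    (hf : ∀ x, x ≠ 0 → f x = φ ‖x‖) (h : ∀ r, R < r → φ r = 0) :
    ∫ x, f x = sphereArea * ∫ y in (0:ℝ)..R, y ^ 2 * φ y := by
  rw [← integral_comp_norm hR h]
  refine integral_congr_ae ?_
  filter_upwards [(Set.countable_singleton (0 : Sp)).ae_notMem volume] with x hx using hf x hx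

/-! ### Energy and initial data of the profile -/

lemma deriv_eq_prof {T : ℝ} (hT : 0 < T) {u : ℝ → Sp → ℝ}
    (hu : IsClassicalSolution (Set.Icc 0 T) u) (hr : IsRadialSolution (Set.Icc 0 T) u) {t : ℝ}
    (ht : t ∈ Set.Icc 0 T) (x : Sp) : deriv (fun s => u s x) t = Dt (prof u) (t, ‖x‖) := by
  have h1 : Differentiable ℝ fun s => u s x :=
    (hu.1.comp (contDiff_id.prodMk contDiff_const)).differentiable (by simp)
  exact deriv_unique_Icc hT ht (h1 t).hasDerivAt (hasDerivAt_t (contDiff_prof hu.1) t ‖x‖)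
    fun s hs => eq_prof_norm hr hs x

lemma Dr_eq_zero {g : ℝ × ℝ → ℝ} (hg : ContDiff ℝ ∞ g) {t R r : ℝ}
    (h : ∀ r, R < r → g (t, r) = 0) (hr : R < r) : Dr g (t, r) = 0 := by
  refine (hasDerivAt_r hg t r).unique ((hasDerivAt_const r (0:ℝ)).congr_of_eventuallyEq ?_)
  filter_upwards [Ioi_mem_nhds hr] with x hx using h x hx

lemma IsProfile.Dt_eq_zero {T : ℝ} {v : ℝ × ℝ → ℝ} (h : IsProfile T v) {R : ℝ}
    (hR : ∀ t ∈ Set.Icc 0 T, ∀ r, R ≤ |r| → v (t, r) = 0) {t r : ℝ} (ht : t ∈ Set.Icc 0 T)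
    (hr : R < r) : Dt v (t, r) = 0 :=
  deriv_unique_Icc h.pos ht (hasDerivAt_t h.smooth t r) (hasDerivAt_const t (0:ℝ))
    (fun s hs => hR s hs r (hr.le.trans (le_abs_self r)))

lemma energy_eq_Phi {T : ℝ} (hT : 0 < T) {u : ℝ → Sp → ℝ}
    (hu : IsClassicalSolution (Set.Icc 0 T) u) (hr : IsRadialSolution (Set.Icc 0 T) u) {R : ℝ}
    (hR0 : 0 < R) (hR : ∀ t ∈ Set.Icc 0 T, ∀ r, R ≤ |r| → prof u (t, r) = 0) {t : ℝ}
    (ht : t ∈ Set.Icc 0 T) : energy u t = sphereArea * Phi (prof u) t R := by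
  have hp := isProfile_prof hT hu hr
  set v := prof u with hv
  have hs := hp.smooth
  have v0 : ∀ r, R < r → v (t, r) = 0 := fun r h => hR t ht r (h.le.trans (le_abs_self r))
  have hut : u t = fun y => v (t, ‖y‖) := funext fun y => eq_prof_norm hr ht y
  rw [energy, integral_eq_of_comp_norm (φ := fun r =>
    1 / 2 * Dt v (t, r) ^ 2 + 1 / 2 * Dr v (t, r) ^ 2 + Fpot (v (t, r))) hR0.le]
  · congr 1
    have d1 : ∀ r, HasDerivAt (fun r => r * v (t, r) ^ 2 / 2)
        (v (t, r) ^ 2 / 2 + r * v (t, r) * Dr v (t, r)) r := fun r => by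
      refine (((hasDerivAt_id r).mul ((hasDerivAt_r hs t r).pow 2)).div_const 2).congr_deriv ?_
      simp only [Pi.pow_apply, id]
      push_cast
      ring
    have cv := continuous_slice hs t
    have cr := continuous_slice (contDiff_Dr hs) t
    have ct := continuous_slice (contDiff_Dt hs) t
    have cF := contDiff_Fpot.continuous.comp cv
    have c1 : Continuous fun r => v (t, r) ^ 2 / 2 + r * v (t, r) * Dr v (t, r) := by fun_prop
    have c2 : Continuous fun y => y ^ 2 * (1 / 2 * Dt v (t, y) ^ 2 + 1 / 2 * Dr v (t, y) ^ 2
        + Fpot (v (t, y))) := by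
      simp only [Function.comp_def] at cF
      fun_prop
    have i1 := intervalIntegral.integral_eq_sub_of_hasDerivAt (a := 0) (b := R)
      (fun x _ => d1 x) (c1.intervalIntegrable _ _)
    have vR : v (t, R) = 0 := hR t ht R (le_abs_self R)
    rw [vR] at i1
    have i2 := intervalIntegral.integral_add (c2.intervalIntegrable (μ := volume) 0 R)
      (c1.intervalIntegrable (μ := volume) 0 R)
    rw [i1] at i2
    norm_num at i2
    norm_num
    rw [← i2, Phi]
    refine intervalIntegral.integral_congr fun y _ => ?_
    simp only [eden, Dt_rad hs, Dr_rad hs]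
    ring
  · intro x hx
    rw [deriv_eq_prof hT hu hr ht, hut,
      sum_sq_pd_comp_norm (φ := fun r => v (t, r)) hx (hasDerivAt_r hs t ‖x‖)]
  · intro r h
    simp [v0 r h, hp.Dt_eq_zero hR ht h, Dr_eq_zero hs v0 h, Fpot_zero]

lemma abs_Phi_le {T : ℝ} {v : ℝ × ℝ → ℝ} (h : IsProfile T v) {t A R : ℝ} (ht : t ∈ Set.Icc 0 T)
    (hA : ∀ r, R ≤ r → Phi v t r ≤ A) (r : ℝ) : |Phi v t r| ≤ A := by
  have p0 : Phi v t 0 = 0 := by simp [Phi]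
  have main : ∀ r, 0 ≤ r → |Phi v t r| ≤ A := fun r hr => by
    have h1 : 0 ≤ Phi v t r := p0 ▸ h.Phi_mono t hr
    rw [abs_of_nonneg h1]
    exact (h.Phi_mono t (le_max_left r R)).trans (hA _ (le_max_right _ _))
  have odd : Phi v t (-r) = -Phi v t r := by
    have e : ∀ x, eden v (t, -x) = eden v (t, x) := fun x => by
      simp only [eden, Dt_rad h.smooth, Dr_rad h.smooth, h.Dt_even ht, h.Dr_odd ht, h.even t ht]
      ring
    have := intervalIntegral.integral_comp_neg (a := 0) (b := r) fun x => eden v (t, x)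
    simp only [e, neg_zero] at this
    rw [Phi, Phi, this, intervalIntegral.integral_symm]
  rcases le_total 0 r with hr | hr
  · exact main r hr
  · rw [← abs_neg, ← odd]
    exact main _ (by linarith)

/-- The radial density of the square of the `H¹` norm of the space-time gradient. -/
def dden (v : ℝ × ℝ → ℝ) (z : ℝ × ℝ) : ℝ :=
  z.2 ^ 2 * (Dt v z ^ 2 + Dr v z ^ 2 + Dr (Dt v) z ^ 2 + Dr (Dr v) z ^ 2) + 2 * Dr v z ^ 2

lemma dden_nonneg (v : ℝ × ℝ → ℝ) (z : ℝ × ℝ) : 0 ≤ dden v z := by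
  unfold dden; positivity

lemma Dquant_sq_eq {T : ℝ} (hT : 0 < T) {u : ℝ → Sp → ℝ}
    (hu : IsClassicalSolution (Set.Icc 0 T) u) (hr : IsRadialSolution (Set.Icc 0 T) u) {R : ℝ}
    (hR0 : 0 < R) (hR : ∀ t ∈ Set.Icc 0 T, ∀ r, R ≤ |r| → prof u (t, r) = 0) {t : ℝ}
    (ht : t ∈ Set.Icc 0 T) :
    Dquant u t ^ 2 = sphereArea * ∫ y in (0:ℝ)..R, dden (prof u) (t, y) := by
  have hp := isProfile_prof hT hu hr
  set v := prof u with hv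
  have hs := hp.smooth
  have v0 : ∀ r, R < r → v (t, r) = 0 := fun r h => hR t ht r (h.le.trans (le_abs_self r))
  have vr0 : ∀ r, R < r → Dr v (t, r) = 0 := fun r h => Dr_eq_zero hs v0 h
  have vt0 : ∀ r, R < r → Dt v (t, r) = 0 := fun r h => hp.Dt_eq_zero hR ht h
  have hut : u t = fun y => v (t, ‖y‖) := funext fun y => eq_prof_norm hr ht y
  rw [Dquant, Real.sq_sqrt (integral_nonneg fun x => by simp only [Pi.zero_apply]; positivity),
    integral_eq_of_comp_norm (φ := fun r => Dt v (t, r) ^ 2 + Dr v (t, r) ^ 2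
      + Dr (Dt v) (t, r) ^ 2 + (Dr (Dr v) (t, r) ^ 2 + 2 * (Dr v (t, r) / r) ^ 2)) hR0.le]
  · congr 1
    refine intervalIntegral.integral_congr fun y _ => ?_
    rcases eq_or_ne y 0 with h0 | h0
    · have := hp.Dr_odd ht 0
      rw [neg_zero] at this
      have h1 : Dr v (t, 0) = 0 := by linarith
      simp [dden, h0, h1]
    · simp only [dden]
      field_simp
      ring
  · intro x hx
    simp only [deriv_eq_prof hT hu hr ht]
    rw [hut, sum_sq_pd_comp_norm (φ := fun r => v (t, r)) hx (hasDerivAt_r hs t ‖x‖),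
      sum_sq_pd_comp_norm (φ := fun r => Dt v (t, r)) hx (hasDerivAt_r (contDiff_Dt hs) t ‖x‖),
      sum_sq_pd_pd_comp_norm (φ := fun r => v (t, r)) hx (fun r => hasDerivAt_r hs t r)
        (fun r => hasDerivAt_r (contDiff_Dr hs) t r)]
  · intro r h
    simp [vr0 r h, vt0 r h, Dr_eq_zero (contDiff_Dr hs) vr0 h, Dr_eq_zero (contDiff_Dt hs) vt0 h]

lemma le_integral_of_neg_le_deriv {H H' p : ℝ → ℝ} {r R : ℝ} (hr : 0 ≤ r) (hrR : r ≤ R)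
    (hH : ∀ s, HasDerivAt H (H' s) s) (hHR : H R = 0) (hp : Continuous p) (hp0 : ∀ s, 0 ≤ p s)
    (h : ∀ s, 0 ≤ s → -p s ≤ H' s) : H r ≤ ∫ s in (0:ℝ)..R, p s := by
  have h1 := integral_le_sub_of_deriv_le hrR (fun t _ => hH t) (g := fun s => -p s)
    hp.neg.continuousOn (fun t ht => h t (hr.trans ht.1))
  rw [intervalIntegral.integral_neg, hHR] at h1
  have h2 := intervalIntegral.integral_add_adjacent_intervals
    (hp.intervalIntegrable (μ := volume) 0 r) (hp.intervalIntegrable (μ := volume) r R)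
  have h3 : 0 ≤ ∫ s in (0:ℝ)..r, p s := intervalIntegral.integral_nonneg hr fun s _ => hp0 s
  linarith

lemma abs_inc_le {T : ℝ} {v : ℝ × ℝ → ℝ} (h : IsProfile T v) {R₀ J t : ℝ} (ht : t ∈ Set.Icc 0 T)
    (hR : ∀ t ∈ Set.Icc 0 T, ∀ r, R₀ ≤ |r| → v (t, r) = 0)
    (hJ : ∀ R, R₀ < R → ∫ y in (0:ℝ)..R, dden v (t, y) ≤ J ^ 2) (hJ0 : 0 ≤ J) (r : ℝ) :
    |inc v (t, r)| ≤ 5 * J := by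
  have hs := h.smooth
  have v0 : ∀ r, R₀ < r → v (t, r) = 0 := fun r h => hR t ht r (h.le.trans (le_abs_self r))
  have cr := continuous_slice (contDiff_Dr hs) t
  have ct := continuous_slice (contDiff_Dt hs) t
  have crr := continuous_slice (contDiff_Dr (contDiff_Dr hs)) t
  have ctr := continuous_slice (contDiff_Dr (contDiff_Dt hs)) t
  have cd : Continuous fun y => dden v (t, y) := by simp only [dden]; fun_prop
  have key : ∀ r, 0 ≤ r → |r * Dt v (t, r)| ≤ J ∧ |r * Dr v (t, r)| ≤ J ∧ |v (t, r)| ≤ 3 * J := by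
    intro r hr
    obtain ⟨R, hR1, hR2⟩ : ∃ R, R₀ < R ∧ r ≤ R :=
      ⟨max (R₀ + 1) r, lt_of_lt_of_le (by linarith) (le_max_left _ _), le_max_right _ _⟩
    have hJR := hJ R hR1
    have vrR := Dr_eq_zero hs v0 hR1
    have vtR := h.Dt_eq_zero hR ht hR1
    have vR := v0 R hR1
    have g1 : ∀ g : ℝ × ℝ → ℝ, ContDiff ℝ ∞ g → g (t, R) = 0 →
        (∀ s, s ^ 2 * (g (t, s) ^ 2 + Dr g (t, s) ^ 2) ≤ dden v (t, s)) →
        |r * g (t, r)| ≤ J := by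
      intro g hg gR hd
      refine abs_le_of_sq_le_sq ?_ hJ0
      refine le_trans (le_integral_of_neg_le_deriv (H := fun s => (s * g (t, s)) ^ 2)
        (H' := fun s => 2 * (s * g (t, s)) * (g (t, s) + s * Dr g (t, s))) hr hR2 (fun s => ?_)
        (by simp [gR]) cd (fun s => dden_nonneg v _) (fun s h0 => ?_)) hJR
      · refine (((hasDerivAt_id s).mul (hasDerivAt_r hg t s)).pow 2).congr_deriv ?_
        simp only [Pi.mul_apply, id]
        push_cast
        ring
      · nlinarith [hd s, mul_nonneg h0 (sq_nonneg (g (t, s))),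
          sq_nonneg (s * g (t, s) + s * Dr g (t, s))]
    refine ⟨g1 _ (contDiff_Dt hs) vtR fun s => ?_, g1 _ (contDiff_Dr hs) vrR fun s => ?_, ?_⟩
    · simp only [dden]
      nlinarith [sq_nonneg (s * Dr v (t, s)), sq_nonneg (s * Dr (Dr v) (t, s)),
        sq_nonneg (Dr v (t, s))]
    · simp only [dden]
      nlinarith [sq_nonneg (s * Dt v (t, s)), sq_nonneg (s * Dr (Dt v) (t, s)),
        sq_nonneg (Dr v (t, s))]
    · refine abs_le_of_sq_le_sq ?_ (by linarith)
      have h1 := le_integral_of_neg_le_deriv (r := r) (R := R)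
        (H := fun s => (1 + s) * v (t, s) ^ 2 + 4 * (s * Dr v (t, s) ^ 2))
        (H' := fun s => v (t, s) ^ 2 + 2 * (1 + s) * v (t, s) * Dr v (t, s)
          + 4 * Dr v (t, s) ^ 2 + 8 * s * Dr v (t, s) * Dr (Dr v) (t, s))
        (p := fun s => 8 * dden v (t, s)) hr hR2 (fun s => by
          have a1 := ((hasDerivAt_id s).const_add 1).mul ((hasDerivAt_r hs t s).pow 2)
          have a2 := (((hasDerivAt_id s).mul
            ((hasDerivAt_r (contDiff_Dr hs) t s).pow 2))).const_mul 4
          refine (a1.add a2).congr_deriv ?_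
          simp only [Pi.pow_apply, id]
          push_cast
          ring) (by simp [vR, vrR])
        (cd.const_mul 8) (fun s => by have := dden_nonneg v (t, s); linarith) (fun s h0 => by
          simp only [dden]
          nlinarith [sq_nonneg (v (t, s) + (1 + s) * Dr v (t, s)),
            sq_nonneg (Dr v (t, s) + 2 * s * Dr (Dr v) (t, s)), sq_nonneg (s * Dt v (t, s)),
            sq_nonneg (s * Dr (Dt v) (t, s)), sq_nonneg (s * Dr (Dr v) (t, s)),
            sq_nonneg (s * Dr v (t, s)), sq_nonneg (Dr v (t, s)),
            sq_nonneg ((1 - s) * Dr v (t, s))])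
      rw [intervalIntegral.integral_const_mul] at h1
      nlinarith [mul_nonneg hr (sq_nonneg (v (t, r))), mul_nonneg hr (sq_nonneg (Dr v (t, r)))]
  have key' : |r * Dt v (t, r)| ≤ J ∧ |r * Dr v (t, r)| ≤ J ∧ |v (t, r)| ≤ 3 * J := by
    rcases le_total 0 r with hr | hr
    · exact key r hr
    · have := key (-r) (by linarith)
      rw [h.Dt_even ht, h.Dr_odd ht, h.even t ht, neg_mul_neg, neg_mul, abs_neg] at this
      exact this
  obtain ⟨k1, k2, k3⟩ := key'
  rw [abs_le] at *
  simp only [inc, Dt_rad hs, Dr_rad hs]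
  constructor <;> linarith [k1.1, k1.2, k2.1, k2.2, k3.1, k3.2]

end LogWave

/-- **Uniform `L^∞` bound.** There is a function `Φ` of the energy `E` and the initial
norm `D₀ = ‖∇_{t,x}u(0)‖_{H¹}` such that every spherically symmetric classical solution
on `[0,T] × ℝ³` obeys `|u(t,x)| ≤ Φ(E, D₀)`, uniformly in `T`. -/
theorem uniform_Linfty_bound :
    ∃ Φ : ℝ × ℝ → ℝ, ∀ T : ℝ, 0 < T → ∀ (u : ℝ → Sp → ℝ) (E : ℝ),
      IsClassicalSolution (Set.Icc 0 T) u →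
      IsRadialSolution (Set.Icc 0 T) u →
      (∀ t ∈ Set.Icc 0 T, energy u t = E) →
      ∀ t ∈ Set.Icc 0 T, ∀ x : Sp,
        |u t x| ≤ Φ (E, Dquant u 0) := by
  have hc := LogWave.sphereArea_pos
  choose C hC using fun p : ℝ × ℝ => LogWave.exists_profile_bound
    (E₁ := |p.1| / LogWave.sphereArea + 1)
    (M₀ := 5 * Real.sqrt (p.2 ^ 2 / LogWave.sphereArea) + 1) (by positivity) (by positivity)
  refine ⟨C, fun T hT u E hu hr hE t ht x => ?_⟩
  have hp := LogWave.isProfile_prof hT hu hr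
  have hn : ∀ t ∈ Set.Icc 0 T, ∃ n : ℕ, ∀ r, (n : ℝ) ≤ r → LogWave.prof u (t, r) = 0 :=
    fun t ht => LogWave.exists_nat_prof_eq_zero hu ht
  obtain ⟨R, hR0, hR⟩ := hp.exists_uniform_support hn
  have h0 : (0:ℝ) ∈ Set.Icc 0 T := Set.left_mem_Icc.2 hT.le
  rw [LogWave.eq_prof_norm hr ht x]
  refine hC (E, Dquant u 0) T _ hp hn (fun t ht r => ?_) (fun r => ?_) t ht _
  · refine (LogWave.abs_Phi_le hp ht (R := R) (fun r hRr => ?_) r).trans (le_add_of_nonneg_right zero_le_one)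
    have e := LogWave.energy_eq_Phi hT hu hr (hR0.trans_le hRr)
      (fun t ht s hs => hR t ht s (hRr.trans hs)) ht
    rw [hE t ht] at e
    rw [le_div_iff₀ hc, mul_comm, ← e]
    exact le_abs_self E
  · refine (LogWave.abs_inc_le hp h0 hR (fun R' hR' => ?_) (Real.sqrt_nonneg _) r).trans
      (le_add_of_nonneg_right zero_le_one)
    have e := LogWave.Dquant_sq_eq hT hu hr (hR0.trans hR')
      (fun t ht s hs => hR t ht s (hR'.le.trans hs)) h0
    rw [Real.sq_sqrt (by positivity), le_div_iff₀ hc, mul_comm, ← e]
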